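/- Assume d ≥ 3, Ω is irreducible, and the torsion-free group Γ divides Ω. If F is a boundary flat of Ω, then the stabilizer Stab_Γ(F) = {γ ∈ Γ : γ̄(F) = F} contains a finite-index subgroup isomorphic to the free abelian group ℤ^{d−1}. -/

import Mathlib

open Set Filter Metric

noncomputable section

/-- `ℝ^d`. -/
abbrev Euc (d : ℕ) := EuclideanSpace ℝ (Fin d)

/-- A flat of `Ω` with prescribed vertices `v`. -/
def IsFlatWith {d : ℕ} (Ω : Set (Euc d)) (v : Fin d → Euc d) : Prop :=
  AffineIndependent ℝ v ∧
  (∀ j, v j ∈ closure Ω \ Ω) ∧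
  intrinsicInterior ℝ (convexHull ℝ (Set.range v)) ⊆ Ω ∧
  convexHull ℝ (Set.range v) \ intrinsicInterior ℝ (convexHull ℝ (Set.range v)) ⊆ closure Ω \ Ω

/-- A (codimension-one, properly embedded) flat of `Ω`. -/
def IsFlat {d : ℕ} (Ω : Set (Euc d)) (F : Set (Euc d)) : Prop :=
  ∃ v : Fin d → Euc d, IsFlatWith Ω v ∧ F = intrinsicInterior ℝ (convexHull ℝ (Set.range v))

/-- The cone over a subset of `ℝ^d`, inside `ℝ^d × ℝ ≅ ℝ^{d+1}`. -/
def coneOver {d : ℕ} (S : Set (Euc d)) : Set (Euc d × ℝ) :=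
  {p | ∃ t : ℝ, 0 < t ∧ ∃ x ∈ S, p = t • (x, (1 : ℝ))}

/-- Irreducibility of a properly convex domain: its cone admits no direct-sum
decomposition into convex cones. -/
def IsIrreducibleDomain {d : ℕ} (Ω : Set (Euc d)) : Prop :=
  ¬ ∃ (V₁ V₂ : Submodule ℝ (Euc d × ℝ)) (C₁ C₂ : Set (Euc d × ℝ)),
      V₁ ≠ ⊥ ∧ V₂ ≠ ⊥ ∧ V₁ ≠ ⊤ ∧ V₂ ≠ ⊤ ∧ IsCompl V₁ V₂ ∧
      C₁ ⊆ (V₁ : Set (Euc d × ℝ)) ∧ C₂ ⊆ (V₂ : Set (Euc d × ℝ)) ∧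
      Convex ℝ C₁ ∧ Convex ℝ C₂ ∧
      (∀ t : ℝ, 0 < t → ∀ c ∈ C₁, t • c ∈ C₁) ∧
      (∀ t : ℝ, 0 < t → ∀ c ∈ C₂, t • c ∈ C₂) ∧
      coneOver Ω = {p | ∃ c₁ ∈ C₁, ∃ c₂ ∈ C₂, p = c₁ + c₂}

/-- The homeomorphism of `Ω` induced by a linear automorphism of `ℝ^{d+1}`
preserving the cone over `Ω`. -/
def projAct {d : ℕ} (g : (Euc d × ℝ) ≃ₗ[ℝ] (Euc d × ℝ)) (x : Euc d) : Euc d :=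
  ((g (x, 1)).2)⁻¹ • (g (x, 1)).1

/-- `Γ` divides `Ω`: every element preserves the cone over `Ω`; the induced action on `Ω`
is free and properly discontinuous, and admits a compact set whose translates cover `Ω`. -/
def Divides {d : ℕ} (Ω : Set (Euc d))
    (Γ : Subgroup ((Euc d × ℝ) ≃ₗ[ℝ] (Euc d × ℝ))) : Prop :=
  (∀ γ ∈ Γ, (γ : (Euc d × ℝ) ≃ₗ[ℝ] (Euc d × ℝ)) '' coneOver Ω = coneOver Ω) ∧
  (∀ γ ∈ Γ, γ ≠ 1 → ∀ x ∈ Ω, projAct γ x ≠ x) ∧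
  (∀ K : Set (Euc d), K ⊆ Ω → IsCompact K →
    {γ : (Euc d × ℝ) ≃ₗ[ℝ] (Euc d × ℝ) | γ ∈ Γ ∧ (projAct γ '' K ∩ K).Nonempty}.Finite) ∧
  (∃ K : Set (Euc d), K ⊆ Ω ∧ IsCompact K ∧ (⋃ γ ∈ Γ, projAct γ '' K) = Ω)

/-- `Γ` is torsion-free. -/
def TorsionFreeSub {d : ℕ} (Γ : Subgroup ((Euc d × ℝ) ≃ₗ[ℝ] (Euc d × ℝ))) : Prop :=
  ∀ γ ∈ Γ, ∀ n : ℕ, n ≠ 0 → γ ^ n = 1 → γ = 1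

/-- Convergence of a sequence of flats: Hausdorff convergence of their closures. -/
def FlatsConverge {d : ℕ} (Fs : ℕ → Set (Euc d)) (F : Set (Euc d)) : Prop :=
  Tendsto (fun i => hausdorffDist (closure (Fs i)) (closure F)) atTop (nhds 0)

/-- A flat is isolated if no sequence of flats, all distinct from it, converges to it. -/
def IsIsolatedFlat {d : ℕ} (Ω F : Set (Euc d)) : Prop :=
  ¬ ∃ Fs : ℕ → Set (Euc d), (∀ i, IsFlat Ω (Fs i)) ∧ (∀ i, Fs i ≠ F) ∧ FlatsConverge Fs F

/-- The union of all flats of `Ω`. -/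
def flatsUnion {d : ℕ} (Ω : Set (Euc d)) : Set (Euc d) := ⋃₀ {F | IsFlat Ω F}

/-- A boundary flat: a flat contained in the closure of a connected component of the
complement of the union of all flats. -/
def IsBoundaryFlat {d : ℕ} (Ω F : Set (Euc d)) : Prop :=
  IsFlat Ω F ∧ ∃ x ∈ Ω \ flatsUnion Ω,
    F ⊆ closure (connectedComponentIn (Ω \ flatsUnion Ω) x)

section ProperCone

variable {V : Type*} [NormedAddCommGroup V] [NormedSpace ℝ V] {ι : Type*} [Fintype ι]

/-- An open convex cone that is properly convex: some continuous functional
dominates the norm on it. -/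
structure IsProperCone (C : Set V) : Prop where
  isOpen : IsOpen C
  convex : Convex ℝ C
  smul_mem : ∀ t : ℝ, 0 < t → ∀ v ∈ C, t • v ∈ C
  proper : ∃ (θ : V →L[ℝ] ℝ) (m : ℝ), 0 < m ∧ ∀ v ∈ C, m * ‖v‖ ≤ θ v

/-- `g` is a linear automorphism of the cone `C`. -/
def IsConeAut (C : Set V) (g : V ≃L[ℝ] V) : Prop := ∀ v, g v ∈ C ↔ v ∈ C

/-- The automorphism group of the proper cone `C` moves every point of `C` into the compact
set `K`. -/
structure IsQuasiHomogeneous (C K : Set V) : Prop extends IsProperCone C where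
  subset : K ⊆ C
  isCompact : IsCompact K
  exists_aut : ∀ v ∈ C, ∃ g, IsConeAut C g ∧ g v ∈ K

/-- `C` does not split off a ray. -/
def IsRayIrreducible (C : Set V) : Prop :=
  ∀ (a : V) (α : V →L[ℝ] ℝ), α a = 1 → (∀ v ∈ C, 0 < α v) →
    ¬ ∀ v ∈ C, ∀ s : ℝ, 0 < α v + s → v + s • a ∈ C

theorem nonneg_of_mem_closure {C : Set V} {φ : V →L[ℝ] ℝ} (h : ∀ v ∈ C, 0 < φ v) {v : V}
    (hv : v ∈ closure C) : 0 ≤ φ v :=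
  (closure_minimal (fun x hx => (h x hx).le : C ⊆ {x | 0 ≤ φ x})
    (isClosed_le continuous_const φ.continuous)) hv

namespace IsProperCone

variable {C : Set V}

theorem add_mem (hC : IsProperCone C) {u v : V} (hu : u ∈ C) (hv : v ∈ C) : u + v ∈ C := by
  have h := hC.convex hu hv (by norm_num : (0 : ℝ) ≤ 1 / 2) (by norm_num : (0 : ℝ) ≤ 1 / 2)
    (by norm_num)
  have h2 := hC.smul_mem 2 (by norm_num) _ h
  simpa [smul_add, smul_smul] using h2

theorem add_closure_mem (hC : IsProperCone C) {u v : V} (hu : u ∈ C)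
    (hv : v ∈ closure C) : u + v ∈ C := by
  have h1 : ∀ᶠ x in nhds v, u + v - x ∈ C := by
    have : Tendsto (fun x => u + v - x) (nhds v) (nhds (u + v - v)) :=
      (continuous_const.sub continuous_id).tendsto v
    rw [add_sub_cancel_right] at this
    exact this.eventually (hC.isOpen.mem_nhds hu)
  obtain ⟨x, hx, hxC⟩ := mem_closure_iff_nhds.1 hv _ h1
  have := hC.add_mem hx hxC
  simpa using this

theorem smul_closure_mem (hC : IsProperCone C) {t : ℝ} (ht : 0 < t) {v : V} (hv : v ∈ closure C) :
    t • v ∈ closure C :=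
  map_mem_closure (continuous_const_smul t) hv fun x hx => hC.smul_mem t ht x hx

theorem add_smul_mem (hC : IsProperCone C) {u v : V} {t : ℝ} (ht : 0 ≤ t) (hu : u ∈ C)
    (hv : v ∈ closure C) :
    u + t • v ∈ C := by
  rcases ht.eq_or_lt with rfl | ht
  · simpa using hu
  · exact hC.add_closure_mem hu (hC.smul_closure_mem ht hv)

theorem add_sum_mem (hC : IsProperCone C) {u : V} {w : ι → V} {c : ι → ℝ} (hu : u ∈ C)
    (hw : ∀ i, w i ∈ closure C)
    (hc : ∀ i, 0 ≤ c i) : u + ∑ i, c i • w i ∈ C := by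
  classical
  suffices ∀ s : Finset ι, u + ∑ i ∈ s, c i • w i ∈ C from this _
  intro s
  induction s using Finset.induction_on with
  | empty => simpa using hu
  | insert a s ha ih =>
    rw [Finset.sum_insert ha, add_left_comm, add_comm]
    exact hC.add_smul_mem (hc a) ih (hw a)

theorem closure_add_sum_mem (hC : IsProperCone C) {u : V} {w : ι → V} {c : ι → ℝ}
    (hu : u ∈ closure C)
    (hw : ∀ i, w i ∈ closure C) (hc : ∀ i, 0 ≤ c i) : u + ∑ i, c i • w i ∈ closure C :=
  map_mem_closure (f := fun x => x + ∑ i, c i • w i) (continuous_id.add continuous_const) hu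
    fun _ hx => hC.add_sum_mem hx hw hc

theorem sum_pos_mem (hC : IsProperCone C) {w : ι → V} {c : ι → ℝ} (hw : ∀ i, w i ∈ closure C)
    (hs : ∑ i, w i ∈ C)
    (hc : ∀ i, 0 < c i) : ∑ i, c i • w i ∈ C := by
  obtain ⟨t, ht, htc⟩ : ∃ t : ℝ, 0 < t ∧ ∀ i, t ≤ c i := by
    rcases isEmpty_or_nonempty ι with h | h
    · exact ⟨1, one_pos, fun i => h.elim i⟩
    · obtain ⟨i, hi⟩ := Finite.exists_min c
      exact ⟨c i, hc i, hi⟩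
  have := hC.add_sum_mem (hC.smul_mem t ht _ hs) hw (c := fun i => c i - t)
    (fun i => sub_nonneg.2 (htc i))
  rw [Finset.smul_sum, ← Finset.sum_add_distrib] at this
  simpa [← add_smul] using this

theorem interior_closure (hC : IsProperCone C) : interior (closure C) = C := by
  rcases C.eq_empty_or_nonempty with rfl | hne
  · simp
  · rw [hC.convex.interior_closure_eq_interior_of_nonempty_interior
      (by rwa [hC.isOpen.interior_eq]), hC.isOpen.interior_eq]

theorem pos_of_nonneg (hC : IsProperCone C) {φ : V →L[ℝ] ℝ} (hφ : φ ≠ 0) (h : ∀ v ∈ C, 0 ≤ φ v) :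
    ∀ v ∈ C, 0 < φ v := by
  intro v hv
  obtain ⟨z, hz⟩ : ∃ z, φ z ≠ 0 := by
    by_contra! h0
    exact hφ (ContinuousLinearMap.ext h0)
  wlog hz' : 0 < φ z generalizing z
  · exact this (-z) (by simpa using hz) (by
      rw [map_neg]; exact neg_pos.2 (lt_of_le_of_ne (not_lt.1 hz') hz))
  have h1 : Tendsto (fun t : ℝ => v - t • z) (nhds 0) (nhds (v - (0 : ℝ) • z)) :=
    Continuous.tendsto (by fun_prop) 0
  rw [zero_smul, sub_zero] at h1
  have h2 := (h1.eventually (hC.isOpen.mem_nhds hv)).filter_mono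
    (nhdsWithin_le_nhds (s := Ioi (0 : ℝ)))
  obtain ⟨t, ht, ht0⟩ := (h2.and self_mem_nhdsWithin).exists
  have h3 := h _ ht
  rw [map_sub, map_smul, smul_eq_mul] at h3
  have : 0 < t * φ z := mul_pos ht0 hz'
  linarith

theorem proper_closure (hC : IsProperCone C) : ∃ (θ : V →L[ℝ] ℝ)
    (m : ℝ), 0 < m ∧ ∀ v ∈ closure C, m * ‖v‖ ≤ θ v := by
  obtain ⟨θ, m, hm, h⟩ := hC.proper
  refine ⟨θ, m, hm, fun v hv => ?_⟩
  exact (closure_minimal (fun x hx => h x hx : C ⊆ {x | m * ‖x‖ ≤ θ x})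
    (isClosed_le (by fun_prop) θ.continuous)) hv

theorem exists_pos_smul_add_mem (hC : IsProperCone C) {u : V} (hu : u ∈ C) (v : V) :
    ∃ t : ℝ, 0 < t ∧ u + t • v ∈ C := by
  have h1 : Tendsto (fun t : ℝ => u + t • v) (nhds 0) (nhds (u + (0 : ℝ) • v)) :=
    Continuous.tendsto (by fun_prop) 0
  rw [zero_smul, add_zero] at h1
  have h2 := (h1.eventually (hC.isOpen.mem_nhds hu)).filter_mono
    (nhdsWithin_le_nhds (s := Ioi (0 : ℝ)))
  obtain ⟨t, ht, ht0⟩ := (h2.and self_mem_nhdsWithin).exists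
  exact ⟨t, ht0, ht⟩

/-- Membership of `u + h • e` is inherited by smaller nonnegative heights. -/
theorem add_smul_mem_of_lt (hC : IsProperCone C) {u e : V} {h h' : ℝ} (hu : u ∈ C) (hh : 0 ≤ h')
    (hlt : h' < h)
    (hm : u + h • e ∈ closure C) : u + h' • e ∈ C := by
  have hpos : 0 < h := hh.trans_lt hlt
  have := hC.add_smul_mem (t := h' / h) (by positivity) (hC.smul_mem (1 - h' / h)
    (by rw [sub_pos, div_lt_one hpos]; exact hlt) _ hu) hm
  convert this using 1
  rw [smul_add, smul_smul, div_mul_cancel₀ _ hpos.ne', ← add_assoc, ← add_smul, sub_add_cancel,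
    one_smul]

end IsProperCone

end ProperCone

section Frames

variable {V : Type*} [NormedAddCommGroup V] [NormedSpace ℝ V] {ι : Type*} [Fintype ι]
  {C K : Set V}

/-- The vectors `w i` span the rays of a codimension-one simplicial section of `C`. -/
def IsFlatTuple (C : Set V) (w : ι → V) : Prop :=
  ∀ c : ι → ℝ, ∑ i, c i • w i ∈ C ↔ ∀ i, 0 < c i

/-- A flat with rays `w`, completed to a basis of `V` by a vector `e`, with dual basis `ξ, η`
such that the hyperplanes `ξ i = 0` support the cone along the facets of the flat. -/
structure FlatFrame {V : Type*} [NormedAddCommGroup V] [NormedSpace ℝ V] (C : Set V)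
    (ι : Type*) [Fintype ι] where
  w : ι → V
  e : V
  ξ : ι → V →L[ℝ] ℝ
  η : V →L[ℝ] ℝ
  ξ_self : ∀ i, ξ i (w i) = 1
  ξ_ne : ∀ i j, i ≠ j → ξ i (w j) = 0
  ξ_e : ∀ i, ξ i e = 0
  η_w : ∀ i, η (w i) = 0
  η_e : η e = 1
  recon : ∀ v, ∑ i, ξ i v • w i + η v • e = v
  pos : ∀ i, ∀ v ∈ C, 0 < ξ i v
  w_mem : ∀ i, w i ∈ closure C
  sum_mem : ∑ i, w i ∈ C

namespace FlatFrame

/-- The same flat with the opposite transverse orientation. -/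
def neg (Fr : FlatFrame C ι) : FlatFrame C ι where
  w := Fr.w
  e := -Fr.e
  ξ := Fr.ξ
  η := -Fr.η
  ξ_self := Fr.ξ_self
  ξ_ne := Fr.ξ_ne
  ξ_e i := by simp [Fr.ξ_e]
  η_w i := by simp [Fr.η_w]
  η_e := by simp [Fr.η_e]
  recon v := by simpa using Fr.recon v
  pos := Fr.pos
  w_mem := Fr.w_mem
  sum_mem := Fr.sum_mem

variable (Fr : FlatFrame C ι)

theorem ξ_sum (c : ι → ℝ) (i : ι) : Fr.ξ i (∑ j, c j • Fr.w j) = c i := by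
  rw [map_sum, Finset.sum_eq_single i]
  · simp [Fr.ξ_self]
  · intro j _ hj
    simp [Fr.ξ_ne i j hj.symm]
  · simp

theorem η_sum (c : ι → ℝ) : Fr.η (∑ j, c j • Fr.w j) = 0 := by
  simp [Fr.η_w]

theorem ξ_point (c : ι → ℝ) (h : ℝ) (i : ι) : Fr.ξ i (∑ j, c j • Fr.w j + h • Fr.e) = c i := by
  rw [map_add, ξ_sum, map_smul, Fr.ξ_e, smul_zero, add_zero]

theorem η_point (c : ι → ℝ) (h : ℝ) : Fr.η (∑ j, c j • Fr.w j + h • Fr.e) = h := by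
  rw [map_add, η_sum, map_smul, Fr.η_e]; simp

theorem ξ_nonneg (i : ι) {v : V} (hv : v ∈ closure C) : 0 ≤ Fr.ξ i v :=
  nonneg_of_mem_closure (Fr.pos i) hv

theorem eq_sum_of_η_eq_zero {v : V} (hv : Fr.η v = 0) : ∑ i, Fr.ξ i v • Fr.w i = v := by
  have := Fr.recon v
  rwa [hv, zero_smul, add_zero] at this

theorem isFlatTuple (hC : IsProperCone C) : IsFlatTuple C Fr.w := fun c =>
  ⟨fun h i => by simpa [Fr.ξ_sum] using Fr.pos i _ h,
    fun h => hC.sum_pos_mem Fr.w_mem Fr.sum_mem h⟩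

/-- Any functional vanishing on the rays of a flat is a multiple of `η`. -/
theorem apply_eq_of_vanish {φ : V →L[ℝ] ℝ} (h : ∀ i, φ (Fr.w i) = 0) (v : V) :
    φ v = φ Fr.e * Fr.η v := by
  conv_lhs => rw [← Fr.recon v]
  simp [h, mul_comm]

theorem η_eq_zero_of_vanish {φ : V →L[ℝ] ℝ} (h : ∀ i, φ (Fr.w i) = 0) {u : V} (hu : φ u ≠ 0)
    {v : V} (hv : φ v = 0) : Fr.η v = 0 := by
  rw [Fr.apply_eq_of_vanish h] at hu hv
  exact (mul_eq_zero.1 hv).resolve_left (left_ne_zero_of_mul hu)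

end FlatFrame

theorem IsFlatTuple.mem_closure {w : ι → V} (h : IsFlatTuple C w) (i : ι) : w i ∈ closure C := by
  classical
  have h1 : Tendsto (fun t : ℝ => ∑ j, (if j = i then 1 else t) • w j) (nhdsWithin 0 (Ioi 0))
      (nhds (∑ j, (if j = i then 1 else (0 : ℝ)) • w j)) := by
    refine Tendsto.mono_left (Continuous.tendsto ?_ (0 : ℝ)) nhdsWithin_le_nhds
    refine continuous_finsetSum _ fun j _ => ?_
    split_ifs <;> fun_prop
  simp only [ite_smul, one_smul, zero_smul, Finset.sum_ite_eq', Finset.mem_univ, if_true] at h1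
  refine mem_closure_of_tendsto h1 ?_
  filter_upwards [self_mem_nhdsWithin] with t ht
  have := (h fun j => if j = i then 1 else t).2 fun j => by
    split_ifs
    exacts [one_pos, ht]
  simpa [ite_smul] using this

theorem IsFlatTuple.sum_mem {w : ι → V} (h : IsFlatTuple C w) : ∑ i, w i ∈ C := by
  simpa using (h fun _ => 1).2 fun _ => one_pos

theorem IsFlatTuple.map {w : ι → V} (h : IsFlatTuple C w) {g : V ≃L[ℝ] V} (hg : IsConeAut C g) :
    IsFlatTuple C fun i => g (w i) := fun c => by
  rw [← h c, ← hg (∑ i, c i • w i)]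
  simp

theorem IsFlatTuple.smul {w : ι → V} (h : IsFlatTuple C w) {s : ι → ℝ} (hs : ∀ i, 0 < s i) :
    IsFlatTuple C fun i => s i • w i := fun c => by
  simp only [smul_smul]
  rw [h]
  exact forall_congr' fun i => by rw [mul_pos_iff_of_pos_right (hs i)]

/-- Flats meeting a compact part of the cone form a closed set. -/
theorem IsFlatTuple.of_tendsto (hC : IsProperCone C) {w : ℕ → ι → V} {w' : ι → V}
    (h : ∀ n, IsFlatTuple C (w n)) (hw : ∀ i, Tendsto (fun n => w n i) atTop (nhds (w' i)))
    (hs : ∑ i, w' i ∈ C) : IsFlatTuple C w' := by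
  have hcl : ∀ i, w' i ∈ closure C := fun i =>
    isClosed_closure.mem_of_tendsto (hw i) (Eventually.of_forall fun n => (h n).mem_closure i)
  refine fun c => ⟨fun hc => ?_, fun hc => hC.sum_pos_mem hcl hs hc⟩
  have : Tendsto (fun n => ∑ i, c i • w n i) atTop (nhds (∑ i, c i • w' i)) :=
    tendsto_finsetSum _ fun i _ => (hw i).const_smul _
  obtain ⟨n, hn⟩ := (this.eventually (hC.isOpen.mem_nhds hc)).exists
  exact (h n c).1 hn

/-- Every flat extends to a frame. -/
theorem IsFlatTuple.exists_frame [FiniteDimensional ℝ V] (hC : IsProperCone C)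
    (hcard : Fintype.card ι + 1 = Module.finrank ℝ V) {w : ι → V} (h : IsFlatTuple C w) :
    ∃ Fr : FlatFrame C ι, Fr.w = w := by
  classical
  have hsupp : ∀ i, ∃ ξ : V →L[ℝ] ℝ, ξ (w i) = 1 ∧ (∀ j, i ≠ j → ξ (w j) = 0) ∧
      ∀ v ∈ C, 0 < ξ v := by
    intro i
    let S : Submodule ℝ V := Submodule.span ℝ (w '' ↑(Finset.univ.erase i))
    have hdisj : Disjoint C (S : Set V) := by
      rw [Set.disjoint_left]
      intro v hv hvS
      obtain ⟨c, rfl⟩ := (Submodule.mem_span_image_finset_iff_exists_fun' ℝ).1 hvS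
      have hv' : ∑ j, (if j = i then 0 else c j) • w j ∈ C := by
        convert hv using 1
        rw [← Finset.add_sum_erase _ _ (Finset.mem_univ i)]
        simp only [if_true, zero_smul, zero_add]
        exact Finset.sum_congr rfl fun j hj => by rw [if_neg (Finset.ne_of_mem_erase hj)]
      simpa using (h _).1 hv' i
    obtain ⟨f, u, hf, hu⟩ := geometric_hahn_banach_open hC.convex hC.isOpen S.convex hdisj
    have hS : ∀ v ∈ S, f v = 0 := by
      intro v hv
      by_contra hne
      have := hu (((u - 1) / f v) • v) (S.smul_mem _ hv)
      rw [map_smul, smul_eq_mul, div_mul_cancel₀ _ hne] at this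
      linarith
    have hu0 : u ≤ 0 := by simpa using hu 0 S.zero_mem
    have hneg : ∀ v ∈ C, f v < 0 := fun v hv => (hf v hv).trans_le hu0
    have hwj : ∀ j, i ≠ j → f (w j) = 0 := fun j hj =>
      hS _ (Submodule.subset_span ⟨j, by simpa using hj.symm, rfl⟩)
    have hwi : f (w i) < 0 := by
      have := hneg _ h.sum_mem
      rwa [map_sum, Finset.sum_eq_single i (fun j _ hj => hwj j hj.symm) (by simp)] at this
    refine ⟨(f (w i))⁻¹ • f, ?_, fun j hj => ?_, fun v hv => ?_⟩
    · simp [hwi.ne]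
    · simp [hwj j hj]
    · exact mul_pos_of_neg_of_neg (inv_lt_zero.2 hwi) (hneg v hv)
  choose ξ h1 h0 hpos using hsupp
  have hξs : ∀ (c : ι → ℝ) i, ξ i (∑ j, c j • w j) = c i := by
    intro c i
    rw [map_sum, Finset.sum_eq_single i]
    · simp [h1]
    · intro j _ hj
      simp [h0 i j hj.symm]
    · simp
  have hli : LinearIndependent ℝ w := by
    rw [Fintype.linearIndependent_iff]
    intro c hc i
    rw [← hξs c i, hc, map_zero]
  let L : V →ₗ[ℝ] (ι → ℝ) := LinearMap.pi fun i => (ξ i : V →ₗ[ℝ] ℝ)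
  have hker : ∃ e : V, (∀ i, ξ i e = 0) ∧ e ≠ 0 := by
    have : LinearMap.ker L ≠ ⊥ := L.ker_ne_bot_of_finrank_lt (by
      rw [Module.finrank_fintype_fun_eq_card]; omega)
    obtain ⟨e, he, hne⟩ := Submodule.exists_mem_ne_zero_of_ne_bot this
    exact ⟨e, fun i => congrFun (LinearMap.mem_ker.1 he) i, hne⟩
  obtain ⟨e, he, hne⟩ := hker
  have hspan : ∀ v : V, ∃ y : ℝ, ∑ i, ξ i v • w i + y • e = v := by
    let b : Option ι → V := fun o => o.elim e w
    have hb : LinearIndependent ℝ b := by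
      rw [Fintype.linearIndependent_iff]
      intro c hc
      rw [Fintype.sum_option] at hc
      have hcs : ∀ i, c (some i) = 0 := fun i => by
        have := congrArg (ξ i) hc
        simpa [b, he, hξs] using this
      have hc0 : c none = 0 := by simpa [b, hcs, hne] using hc
      rintro (_ | i)
      exacts [hc0, hcs i]
    have htop := hb.span_eq_top_of_card_eq_finrank' (by simpa using hcard)
    intro v
    have hv : v ∈ Submodule.span ℝ (range b) := htop ▸ Submodule.mem_top
    obtain ⟨c, rfl⟩ := (Submodule.mem_span_range_iff_exists_fun ℝ).1 hv
    refine ⟨c none, ?_⟩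
    rw [Fintype.sum_option]
    simp [b, he, hξs, add_comm]
  choose y hy using hspan
  have hyu : ∀ v t, v = ∑ i, ξ i v • w i + t • e → y v = t := by
    intro v t hv
    have h2 := (hy v).trans hv
    rw [add_right_inj] at h2
    exact smul_left_injective ℝ hne h2
  let η : V →ₗ[ℝ] ℝ :=
    { toFun := y
      map_add' := fun u v => hyu _ _ (by
        conv_lhs => rw [← hy u, ← hy v]
        simp only [map_add, add_smul, Finset.sum_add_distrib]
        abel)
      map_smul' := fun t v => hyu _ _ (by
        conv_lhs => rw [← hy v]
        simp [smul_smul, Finset.smul_sum]) }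
  exact ⟨{  w := w
            e := e
            ξ := ξ
            η := LinearMap.toContinuousLinearMap η
            ξ_self := h1
            ξ_ne := h0
            ξ_e := he
            η_w := fun i => hyu _ _ (by
              rw [zero_smul, add_zero, Finset.sum_eq_single i]
              · simp [h1]
              · intro j _ hj
                simp [h0 j i hj]
              · simp)
            η_e := hyu _ _ (by simp [he])
            recon := hy
            pos := hpos
            w_mem := h.mem_closure
            sum_mem := h.sum_mem }, rfl⟩

end Frames

section Compactness

variable {V : Type*} [NormedAddCommGroup V] [NormedSpace ℝ V] {ι : Type*} [Fintype ι]
  {C K : Set V}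

namespace IsConeAut

theorem symm {g : V ≃L[ℝ] V} (hg : IsConeAut C g) : IsConeAut C g.symm := fun v => by
  rw [← hg, g.apply_symm_apply]

theorem map_closure {g : V ≃L[ℝ] V} (hg : IsConeAut C g) {v : V} (hv : v ∈ closure C) :
    g v ∈ closure C :=
  map_mem_closure g.continuous hv fun x hx => (hg x).2 hx

end IsConeAut

/-- Functionals that are nonnegative on the cone are controlled by their values on `K`. -/
theorem IsQuasiHomogeneous.exists_functional_bound (hQ : IsQuasiHomogeneous C K) :
    ∃ B : ℝ, 0 < B ∧ ∀ φ : V →L[ℝ] ℝ, (∀ v ∈ C, 0 ≤ φ v) → ∀ k ∈ K, ‖φ‖ ≤ B * φ k := by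
  obtain ⟨δ, hδ, hsub⟩ := hQ.isCompact.exists_cthickening_subset_open hQ.isOpen hQ.subset
  refine ⟨δ⁻¹, inv_pos.2 hδ, fun φ hφ k hk => ?_⟩
  have hk0 : 0 ≤ φ k := hφ k (hQ.subset hk)
  have hball : ∀ u : V, ‖u‖ ≤ δ → 0 ≤ φ (k + u) := fun u hu =>
    hφ _ (hsub (mem_cthickening_of_dist_le _ k _ _ hk (by simpa [dist_eq_norm] using hu)))
  refine φ.opNorm_le_bound (by positivity) fun v => ?_
  rcases eq_or_ne v 0 with rfl | hv
  · simp
  have hv' : 0 < ‖v‖ := norm_pos_iff.2 hv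
  have hn : ‖(δ / ‖v‖) • v‖ ≤ δ := by
    rw [norm_smul, Real.norm_of_nonneg (by positivity), div_mul_cancel₀ _ hv'.ne']
  have h1 := hball _ hn
  have h2 := hball (-((δ / ‖v‖) • v)) (by rwa [norm_neg])
  rw [map_add, map_smul, smul_eq_mul] at h1
  rw [map_add, map_neg, map_smul, smul_eq_mul] at h2
  rw [Real.norm_eq_abs]
  have h3 : δ / ‖v‖ * |φ v| ≤ φ k := by
    rcases abs_cases (φ v) with ⟨h, _⟩ | ⟨h, _⟩ <;> rw [h] <;> linarith
  calc |φ v| = δ⁻¹ * ((δ / ‖v‖ * |φ v|) * ‖v‖) := by field_simp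
    _ ≤ δ⁻¹ * (φ k * ‖v‖) := by gcongr
    _ = δ⁻¹ * φ k * ‖v‖ := by ring

theorem IsQuasiHomogeneous.exists_sum_bound (hQ : IsQuasiHomogeneous C K) :
    ∃ B : ℝ, 0 < B ∧ ∀ w : ι → V, (∀ i, w i ∈ closure C) → ∑ i, w i ∈ K →
      ∀ i, ‖w i‖ ≤ B := by
  classical
  obtain ⟨θ, m, hm, hθ⟩ := hQ.proper_closure
  obtain ⟨M, hM⟩ := hQ.isCompact.exists_bound_of_continuousOn θ.continuous.continuousOn
  refine ⟨max (M / m) 1, by positivity, fun w hw h i => le_max_of_le_left ?_⟩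
  rw [le_div_iff₀ hm]
  have h1 := hM _ h
  have h2 := hθ (w i) (hw i)
  have h3 : θ (w i) ≤ ∑ j, θ (w j) :=
    Finset.single_le_sum (f := fun j => θ (w j))
      (fun j _ => le_trans (by positivity) (hθ _ (hw j))) (Finset.mem_univ i)
  rw [Real.norm_eq_abs, map_sum] at h1
  have := (le_abs_self _).trans h1
  linarith

theorem FlatFrame.recon_conj (Fr : FlatFrame C ι) (g : V ≃L[ℝ] V) {c : ι → ℝ} {τ : ℝ}
    (hc : ∀ i, 0 < c i) (hτ : 0 < τ) (v : V) :
    ∑ i, ((c i)⁻¹ • (Fr.ξ i).comp (g.symm : V →L[ℝ] V)) v • g (c i • Fr.w i) +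
      (τ⁻¹ • Fr.η.comp (g.symm : V →L[ℝ] V)) v • g (τ • Fr.e) = v := by
  conv_rhs => rw [← g.apply_symm_apply v, ← Fr.recon (g.symm v)]
  simp only [map_add, map_sum, map_smul, smul_smul, smul_apply,
    ContinuousLinearMap.comp_apply, ContinuousLinearEquiv.coe_coe, smul_eq_mul]
  congr 1
  · refine Finset.sum_congr rfl fun i _ => ?_
    rw [mul_right_comm, inv_mul_cancel₀ (hc i).ne', one_mul]
  · rw [mul_right_comm, inv_mul_cancel₀ hτ.ne', one_mul]

/-- Bounded sequences of dual bases subconverge. -/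
theorem exists_subseq_basis [FiniteDimensional ℝ V] {w : ℕ → ι → V} {e : ℕ → V}
    {ξ : ℕ → ι → V →L[ℝ] ℝ} {η : ℕ → V →L[ℝ] ℝ} {M : ℝ} (hw : ∀ n i, ‖w n i‖ ≤ M)
    (he : ∀ n, ‖e n‖ ≤ M) (hξ : ∀ n i, ‖ξ n i‖ ≤ M) (hη : ∀ n, ‖η n‖ ≤ M) :
    ∃ (φ : ℕ → ℕ) (w' : ι → V) (e' : V) (ξ' : ι → V →L[ℝ] ℝ) (η' : V →L[ℝ] ℝ), StrictMono φ ∧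
      (∀ i, Tendsto (fun n => w (φ n) i) atTop (nhds (w' i))) ∧
      Tendsto (fun n => e (φ n)) atTop (nhds e') ∧
      (∀ i, Tendsto (fun n => ξ (φ n) i) atTop (nhds (ξ' i))) ∧
      Tendsto (fun n => η (φ n)) atTop (nhds η') := by
  have : ProperSpace V := FiniteDimensional.proper ℝ V
  have : ProperSpace (V →L[ℝ] ℝ) := FiniteDimensional.proper ℝ _
  have h0 : 0 ≤ M := (norm_nonneg _).trans (he 0)
  let x : ℕ → (ι → V) × V × (ι → V →L[ℝ] ℝ) × (V →L[ℝ] ℝ) := fun n => (w n, e n, ξ n, η n)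
  have hx : ∀ n, x n ∈ closedBall (0 : (ι → V) × V × (ι → V →L[ℝ] ℝ) × (V →L[ℝ] ℝ)) M := by
    intro n
    rw [mem_closedBall_zero_iff]
    simp only [x, Prod.norm_def, max_le_iff]
    exact ⟨(pi_norm_le_iff_of_nonneg h0).2 (hw n), he n, (pi_norm_le_iff_of_nonneg h0).2 (hξ n),
      hη n⟩
  obtain ⟨⟨w', e', ξ', η'⟩, -, φ, hφ, hlim⟩ := tendsto_subseq_of_bounded isBounded_closedBall hx
  rw [nhds_prod_eq, nhds_prod_eq, nhds_prod_eq] at hlim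
  have h1 := hlim.fst
  have h2 := hlim.snd.fst
  have h3 := hlim.snd.snd.fst
  have h4 := hlim.snd.snd.snd
  exact ⟨φ, w', e', ξ', η', hφ, tendsto_pi_nhds.1 h1, h2, tendsto_pi_nhds.1 h3, h4⟩

/-- The frames `(c n i • w i, τ n • e)`, transported by automorphisms `g n`, converge. -/
structure NormLim (Fr Fr' : FlatFrame C ι) (c : ℕ → ι → ℝ) (τ : ℕ → ℝ)
    (g : ℕ → V ≃L[ℝ] V) : Prop where
  aut : ∀ n, IsConeAut C (g n)
  c_pos : ∀ n i, 0 < c n i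
  τ_pos : ∀ n, 0 < τ n
  w_lim : ∀ i, Tendsto (fun n => g n (c n i • Fr.w i)) atTop (nhds (Fr'.w i))
  e_lim : Tendsto (fun n => g n (τ n • Fr.e)) atTop (nhds Fr'.e)
  ξ_lim : ∀ i, Tendsto (fun n => (c n i)⁻¹ • (Fr.ξ i).comp ((g n).symm : V →L[ℝ] V)) atTop
    (nhds (Fr'.ξ i))
  η_lim : Tendsto (fun n => (τ n)⁻¹ • Fr.η.comp ((g n).symm : V →L[ℝ] V)) atTop (nhds Fr'.η)

theorem NormLim.comp {Fr Fr' : FlatFrame C ι} {c : ℕ → ι → ℝ} {τ : ℕ → ℝ} {g : ℕ → V ≃L[ℝ] V}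
    (h : NormLim Fr Fr' c τ g) {φ : ℕ → ℕ} (hφ : StrictMono φ) :
    NormLim Fr Fr' (fun n => c (φ n)) (fun n => τ (φ n)) (fun n => g (φ n)) where
  aut n := h.aut (φ n)
  c_pos n := h.c_pos (φ n)
  τ_pos n := h.τ_pos (φ n)
  w_lim i := (h.w_lim i).comp hφ.tendsto_atTop
  e_lim := h.e_lim.comp hφ.tendsto_atTop
  ξ_lim i := (h.ξ_lim i).comp hφ.tendsto_atTop
  η_lim := h.η_lim.comp hφ.tendsto_atTop

theorem NormLim.point_lim {Fr Fr' : FlatFrame C ι} {c : ℕ → ι → ℝ} {τ : ℕ → ℝ}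
    {g : ℕ → V ≃L[ℝ] V} (h : NormLim Fr Fr' c τ g) {x : ℕ → ι → ℝ} {y : ℕ → ℝ} {x' : ι → ℝ}
    {y' : ℝ} (hx : ∀ i, Tendsto (fun n => x n i) atTop (nhds (x' i)))
    (hy : Tendsto y atTop (nhds y')) :
    Tendsto (fun n => g n (∑ i, (c n i * x n i) • Fr.w i + (τ n * y n) • Fr.e)) atTop
      (nhds (∑ i, x' i • Fr'.w i + y' • Fr'.e)) := by
  have := (tendsto_finsetSum Finset.univ fun i _ => (hx i).smul (h.w_lim i)).add
    (hy.smul h.e_lim)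
  refine this.congr fun n => ?_
  simp only [map_add, map_sum, map_smul, smul_smul]
  congr 1
  · exact Finset.sum_congr rfl fun i _ => by rw [mul_comm]
  · rw [mul_comm]

theorem tendsto_const_eq {X : Type*} [TopologicalSpace X] [T2Space X] {f : ℕ → X} {a b : X}
    (h : Tendsto f atTop (nhds a)) (hf : ∀ n, f n = b) : a = b :=
  tendsto_nhds_unique h (tendsto_const_nhds.congr fun n => (hf n).symm)

theorem tendsto_clm_apply {F : Type*} [NormedAddCommGroup F] [NormedSpace ℝ F]
    {f : ℕ → V →L[ℝ] F} {f' : V →L[ℝ] F} {v : ℕ → V} {v' : V}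
    (hf : Tendsto f atTop (nhds f')) (hv : Tendsto v atTop (nhds v')) :
    Tendsto (fun n => f n (v n)) atTop (nhds (f' v')) :=
  ((isBoundedBilinearMap_apply (𝕜 := ℝ) (E := V) (F := F)).continuous.tendsto (f', v')).comp
    (hf.prodMk_nhds hv)

variable [FiniteDimensional ℝ V]

/-- Any sequence of positive weights on a flat can be normalised along a subsequence. -/
theorem IsQuasiHomogeneous.exists_normLim (hQ : IsQuasiHomogeneous C K) (Fr : FlatFrame C ι)
    (c : ℕ → ι → ℝ) (hc : ∀ n i, 0 < c n i) :
    ∃ φ : ℕ → ℕ, StrictMono φ ∧ ∃ (τ : ℕ → ℝ) (g : ℕ → V ≃L[ℝ] V) (Fr' : FlatFrame C ι),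
      NormLim Fr Fr' (fun n => c (φ n)) τ g := by
  classical
  have hcC : ∀ n, ∑ i, c n i • Fr.w i ∈ C := fun n =>
    hQ.sum_pos_mem Fr.w_mem Fr.sum_mem (hc n)
  choose g hg hgK using fun n => hQ.exists_aut _ (hcC n)
  let τ : ℕ → ℝ := fun n => ‖Fr.η.comp ((g n).symm : V →L[ℝ] V)‖
  have hτ : ∀ n, 0 < τ n := by
    intro n
    rw [norm_pos_iff]
    intro h0
    have := congrArg (fun f => f (g n Fr.e)) h0
    simp [Fr.η_e] at this
  let w : ℕ → ι → V := fun n i => g n (c n i • Fr.w i)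
  let e : ℕ → V := fun n => g n (τ n • Fr.e)
  let ξ : ℕ → ι → V →L[ℝ] ℝ := fun n i => (c n i)⁻¹ • (Fr.ξ i).comp ((g n).symm : V →L[ℝ] V)
  let η : ℕ → V →L[ℝ] ℝ := fun n => (τ n)⁻¹ • Fr.η.comp ((g n).symm : V →L[ℝ] V)
  have hrec : ∀ n v, ∑ i, ξ n i v • w n i + η n v • e n = v := fun n v =>
    Fr.recon_conj (g n) (hc n) (hτ n) v
  have hwcl : ∀ n i, w n i ∈ closure C := fun n i =>
    (hg n).map_closure (hQ.smul_closure_mem (hc n i) (Fr.w_mem i))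
  have hsumK : ∀ n, ∑ i, w n i ∈ K := fun n => by
    have := hgK n
    rwa [map_sum] at this
  have hξpos : ∀ n i, ∀ v ∈ C, 0 < ξ n i v := fun n i v hv =>
    mul_pos (inv_pos.2 (hc n i)) (Fr.pos i _ (((hg n).symm v).2 hv))
  have hξw : ∀ n i j, ξ n i (w n j) = if i = j then 1 else 0 := by
    intro n i j
    split_ifs with hij
    · subst hij
      simp [ξ, w, Fr.ξ_self, (hc n i).ne']
    · simp [ξ, w, Fr.ξ_ne i j hij]
  have hξe : ∀ n i, ξ n i (e n) = 0 := fun n i => by simp [ξ, e, Fr.ξ_e]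
  have hηw : ∀ n i, η n (w n i) = 0 := fun n i => by simp [η, w, Fr.η_w]
  have hηe : ∀ n, η n (e n) = 1 := fun n => by simp [η, e, Fr.η_e, (hτ n).ne']
  obtain ⟨B1, hB1, hb1⟩ := hQ.exists_sum_bound (ι := ι)
  obtain ⟨B2, hB2, hb2⟩ := hQ.exists_functional_bound
  have hwb : ∀ n i, ‖w n i‖ ≤ B1 := fun n i => hb1 _ (hwcl n) (hsumK n) i
  have hξb : ∀ n i, ‖ξ n i‖ ≤ B2 := by
    intro n i
    have := hb2 (ξ n i) (fun v hv => (hξpos n i v hv).le) _ (hsumK n)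
    rwa [map_sum, Finset.sum_congr rfl fun j _ => hξw n i j, Finset.sum_ite_eq,
      if_pos (Finset.mem_univ i), mul_one] at this
  have hηb : ∀ n, ‖η n‖ = 1 := by
    intro n
    simp only [η]
    rw [norm_smul, norm_inv, Real.norm_of_nonneg (hτ n).le]
    exact inv_mul_cancel₀ (hτ n).ne'
  have heb : ∀ n, ‖e n‖ ≤ 2 * (1 + Fintype.card ι * (B2 * B1)) := by
    intro n
    obtain ⟨v, hv1, hv⟩ := (η n).exists_lt_apply_of_lt_opNorm
      (show (1 / 2 : ℝ) < ‖η n‖ by rw [hηb]; norm_num)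
    have h1 : η n v • e n = v - ∑ i, ξ n i v • w n i := by
      rw [eq_sub_iff_add_eq, add_comm]; exact hrec n v
    have h2 : ‖∑ i, ξ n i v • w n i‖ ≤ Fintype.card ι * (B2 * B1) := by
      refine (norm_sum_le _ _).trans ?_
      rw [← nsmul_eq_mul]
      refine Finset.sum_le_card_nsmul _ _ _ fun i _ => ?_
      rw [norm_smul]
      refine mul_le_mul ?_ (hwb n i) (norm_nonneg _) hB2.le
      calc ‖ξ n i v‖ ≤ ‖ξ n i‖ * ‖v‖ := (ξ n i).le_opNorm v
        _ ≤ B2 * 1 := mul_le_mul (hξb n i) hv1.le (norm_nonneg _) hB2.le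
        _ = B2 := mul_one _
    have h3 : ‖η n v‖ * ‖e n‖ ≤ 1 + Fintype.card ι * (B2 * B1) := by
      rw [← norm_smul, h1]
      exact (norm_sub_le _ _).trans (add_le_add hv1.le h2)
    have h4 : 1 / 2 * ‖e n‖ ≤ ‖η n v‖ * ‖e n‖ := by gcongr
    linarith
  obtain ⟨φ, w', e', ξ', η', hφ, hlw, hle, hlξ, hlη⟩ := exists_subseq_basis
    (w := w) (e := e) (ξ := ξ) (η := η)
    (M := max (max B1 B2) (max 1 (2 * (1 + Fintype.card ι * (B2 * B1)))))
    (fun n i => (hwb n i).trans (by simp)) (fun n => (heb n).trans (by simp))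
    (fun n i => (hξb n i).trans (by simp)) (fun n => (hηb n).le.trans (by simp))
  have hξself : ∀ i, ξ' i (w' i) = 1 := fun i =>
    tendsto_const_eq (tendsto_clm_apply (hlξ i) (hlw i)) fun n => by simp [hξw]
  have hwcl' : ∀ i, w' i ∈ closure C := fun i =>
    isClosed_closure.mem_of_tendsto (hlw i) (Eventually.of_forall fun n => hwcl _ i)
  refine ⟨φ, hφ, fun n => τ (φ n), fun n => g (φ n),
    { w := w', e := e', ξ := ξ', η := η'
      ξ_self := hξself
      ξ_ne := fun i j hij =>
        tendsto_const_eq (tendsto_clm_apply (hlξ i) (hlw j)) fun n => by simp [hξw, hij]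
      ξ_e := fun i => tendsto_const_eq (tendsto_clm_apply (hlξ i) hle) fun n => hξe _ i
      η_w := fun i => tendsto_const_eq (tendsto_clm_apply hlη (hlw i)) fun n => hηw _ i
      η_e := tendsto_const_eq (tendsto_clm_apply hlη hle) fun n => hηe _
      recon := fun v => tendsto_const_eq ((tendsto_finsetSum Finset.univ fun i _ =>
        (tendsto_clm_apply (hlξ i) tendsto_const_nhds).smul (hlw i)).add
        ((tendsto_clm_apply hlη tendsto_const_nhds).smul hle)) fun n => hrec _ v
      pos := fun i => hQ.pos_of_nonneg (fun h0 => by simpa [h0] using hξself i) fun v hv =>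
        ge_of_tendsto' (tendsto_clm_apply (hlξ i) tendsto_const_nhds)
          fun n => (hξpos _ i v hv).le
      w_mem := hwcl'
      sum_mem := hQ.subset (hQ.isCompact.isClosed.mem_of_tendsto
        (tendsto_finsetSum Finset.univ fun i _ => hlw i)
        (Eventually.of_forall fun n => hsumK _)) },
    { aut := fun n => hg _
      c_pos := fun n => hc _
      τ_pos := fun n => hτ _
      w_lim := hlw, e_lim := hle, ξ_lim := hlξ, η_lim := hlη }⟩

end Compactness

section Degeneration

variable {V : Type*} [NormedAddCommGroup V] [NormedSpace ℝ V] {ι : Type*} [Fintype ι]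
  {C K : Set V}

/-- A degenerating sequence of automorphisms that separates a direction `a` from a complement
forces the cone to split off a ray. -/
theorem IsRayIrreducible.false_of_degeneration (hC : IsProperCone C) (hirr : IsRayIrreducible C)
    {g : ℕ → V ≃L[ℝ] V} (hg : ∀ n, IsConeAut C (g n)) {a a0 : V} {α : V →L[ℝ] ℝ} {Q : V → V}
    {r : ℕ → ℝ} (ha0 : a0 ∈ closure C) (hr : ∀ n, 0 < r n) (hα : α a = 1)
    (hQ : ∀ v (s : ℝ), Q (v + s • a) = Q v) (hpos : ∀ v ∈ C, 0 < α v)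
    (hlim : ∀ v, Tendsto (fun n => g n (Q v + (r n * α v) • a0)) atTop (nhds v))
    (hdrop : Tendsto r atTop atTop ∨ Tendsto r atTop (nhds 0)) : False := by
  have hdrop' : ∀ κ : ℝ, 0 < κ → ∀ N : ℕ, ∃ᶠ m in atTop, ∃ n ≥ N, r n ≤ κ * r m := by
    intro κ hκ N
    rcases hdrop with h | h
    · refine Eventually.frequently ?_
      filter_upwards [h.eventually_ge_atTop (r N / κ)] with m hm
      exact ⟨N, le_rfl, by rwa [div_le_iff₀' hκ] at hm⟩
    · refine Eventually.frequently (Eventually.of_forall fun m => ?_)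
      have h1 := h.eventually (eventually_lt_nhds (mul_pos hκ (hr m)))
      obtain ⟨n, hn, hnN⟩ := (h1.and (eventually_ge_atTop N)).exists
      exact ⟨n, hnN, hn.le⟩
  have key : ∀ v ∈ C, ∀ s : ℝ, 0 < α v + s → v + s • a ∈ closure C := by
    intro v hv s hs
    have hαv : α (v + s • a) = α v + s := by simp [hα]
    have h1 := (hlim v).eventually (hC.isOpen.mem_nhds hv)
    obtain ⟨N, hN⟩ := eventually_atTop.1 h1
    have h2 := hdrop' ((α v + s) / α v) (div_pos hs (hpos v hv)) N
    refine mem_closure_of_frequently_of_tendsto (h2.mono ?_) (hlim (v + s • a))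
    rintro m ⟨n, hn, hle⟩
    rw [hg, hQ, hαv]
    have h3 := (hg n _).1 (hN n hn)
    have h4 : 0 ≤ r m * (α v + s) - r n * α v := by
      have := mul_le_mul_of_nonneg_right hle (hpos v hv).le
      rw [mul_right_comm, div_mul_cancel₀ _ (hpos v hv).ne'] at this
      linarith
    have h5 := hC.add_smul_mem h4 h3 ha0
    rwa [add_assoc, ← add_smul, add_sub_cancel] at h5
  refine hirr a α hα hpos fun v hv s hs => ?_
  rw [← hC.interior_closure, mem_interior]
  refine ⟨{u | u - s • a ∈ C ∧ 0 < α u}, fun u hu => ?_, ?_, ?_⟩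
  · have := key _ hu.1 s (by simpa [hα] using hu.2)
    rwa [sub_add_cancel] at this
  · exact (hC.isOpen.preimage (continuous_id.sub continuous_const)).inter
      (isOpen_lt continuous_const α.continuous)
  · exact ⟨by simpa using hv, by simpa [hα] using hs⟩

theorem NormLim.exists_height_bound (hC : IsProperCone C) {Fr Fr' : FlatFrame C ι}
    {c : ℕ → ι → ℝ} {τ : ℕ → ℝ} {g : ℕ → V ≃L[ℝ] V} (h : NormLim Fr Fr' c τ g)
    (he : Fr'.e ∉ closure C) :
    ∃ B : ℝ, 0 < B ∧ ∀ᶠ n in atTop, ∀ t : ℝ,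
      ∑ i, c n i • Fr.w i + t • Fr.e ∈ closure C → t ≤ B * τ n := by
  obtain ⟨ε, hε, hball⟩ := Metric.isOpen_iff.1 (isClosed_closure (s := C)).isOpen_compl _ he
  have h1 := (tendsto_finsetSum Finset.univ fun i _ => h.w_lim i).norm.eventually
    (eventually_lt_nhds (lt_add_one _))
  have h2 := h.e_lim.eventually (ball_mem_nhds _ (half_pos hε))
  set M := ‖∑ i, Fr'.w i‖ + 1
  have hM : 0 < M := by positivity
  refine ⟨2 * M / ε, by positivity, ?_⟩
  filter_upwards [h1, h2] with n hn1 hn2 t ht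
  by_contra! hlt
  have hτ := h.τ_pos n
  have ht0 : 0 < t := lt_trans (by positivity) hlt
  have hmem : (τ n / t) • g n (∑ i, c n i • Fr.w i + t • Fr.e) ∈ closure C :=
    hC.smul_closure_mem (by positivity) ((h.aut n).map_closure ht)
  refine hball ?_ hmem
  rw [dist_eq_norm] at hn2
  rw [mem_ball, dist_eq_norm]
  have hexp : (τ n / t) • g n (∑ i, c n i • Fr.w i + t • Fr.e) - Fr'.e =
      (τ n / t) • ∑ i, g n (c n i • Fr.w i) + (g n (τ n • Fr.e) - Fr'.e) := by
    rw [map_add, smul_add, map_sum, ← map_smul (g n) _ (t • Fr.e), smul_smul,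
      div_mul_cancel₀ _ ht0.ne', add_sub_assoc]
  rw [hexp]
  refine (norm_add_le _ _).trans_lt ?_
  have h3 : ‖(τ n / t) • ∑ i, g n (c n i • Fr.w i)‖ ≤ ε / 2 := by
    rw [norm_smul, Real.norm_of_nonneg (by positivity)]
    calc τ n / t * ‖∑ i, g n (c n i • Fr.w i)‖ ≤ τ n / t * M := by gcongr
      _ ≤ ε / 2 := by
        rw [div_mul_eq_mul_div, div_le_iff₀ ht0]
        rw [div_mul_eq_mul_div, div_lt_iff₀ hε] at hlt
        linarith
  linarith

theorem NormLim.exists_height_mem (hC : IsProperCone C) {Fr Fr' : FlatFrame C ι}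
    {c : ℕ → ι → ℝ} {τ : ℕ → ℝ} {g : ℕ → V ≃L[ℝ] V} (h : NormLim Fr Fr' c τ g) :
    ∃ y : ℝ, 0 < y ∧ ∀ᶠ n in atTop, ∑ i, c n i • Fr.w i + (y * τ n) • Fr.e ∈ C := by
  obtain ⟨y, hy, hmem⟩ := hC.exists_pos_smul_add_mem Fr'.sum_mem Fr'.e
  refine ⟨y, hy, ?_⟩
  have h1 := h.point_lim (x := fun _ _ => 1) (x' := fun _ => 1) (y := fun _ => y) (y' := y)
    (fun i => tendsto_const_nhds) tendsto_const_nhds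
  simp only [one_smul, mul_one] at h1
  filter_upwards [h1.eventually (hC.isOpen.mem_nhds hmem)] with n hn
  rw [mul_comm y]
  exact (h.aut n _).1 hn

/-- Scaling one ray of a flat to an extreme must also change the transverse scale. -/
theorem NormLim.false_of_bounded (hC : IsProperCone C) (hirr : IsRayIrreducible C)
    {Fr Fr' : FlatFrame C ι} {c : ℕ → ι → ℝ} {τ : ℕ → ℝ} {g : ℕ → V ≃L[ℝ] V}
    (h : NormLim Fr Fr' c τ g) (b : ι) (hb : ∀ n i, i ≠ b → c n i = 1)
    (hr : Tendsto (fun n => c n b) atTop atTop ∨ Tendsto (fun n => c n b) atTop (nhds 0))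
    {lo hi : ℝ} (hlo : 0 < lo) (hτ : ∀ᶠ n in atTop, τ n ∈ Icc lo hi) : False := by
  classical
  obtain ⟨t, ht, φ, hφ, hlim⟩ := isCompact_Icc.tendsto_subseq' hτ.frequently
  have ht0 : 0 < t := hlo.trans_le ht.1
  have h' := h.comp hφ
  refine hirr.false_of_degeneration hC h'.aut (a := Fr'.w b) (a0 := Fr.w b) (α := Fr'.ξ b)
    (Q := fun v => ∑ i, (if i = b then 0 else Fr'.ξ i v) • Fr.w i + (t * Fr'.η v) • Fr.e)
    (r := fun n => c (φ n) b) (Fr.w_mem b) (fun n => h'.c_pos n b) (Fr'.ξ_self b) ?_ (Fr'.pos b)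
    ?_ (hr.imp (fun h => h.comp hφ.tendsto_atTop) fun h => h.comp hφ.tendsto_atTop)
  · intro v s
    simp only [map_add, map_smul, Fr'.η_w, smul_zero, add_zero]
    congr 1
    refine Finset.sum_congr rfl fun i _ => ?_
    split_ifs with hi
    · rfl
    · rw [Fr'.ξ_ne i b hi, smul_zero, add_zero]
  · intro v
    have hy : Tendsto (fun n => t * Fr'.η v / τ (φ n)) atTop (nhds (Fr'.η v)) := by
      have := (tendsto_const_nhds (x := t * Fr'.η v)).div hlim ht0.ne'
      rwa [mul_div_cancel_left₀ _ ht0.ne'] at this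
    have h1 := h'.point_lim (x := fun _ i => Fr'.ξ i v) (x' := fun i => Fr'.ξ i v)
      (fun i => tendsto_const_nhds) hy
    rw [Fr'.recon] at h1
    refine h1.congr fun n => congrArg _ ?_
    rw [mul_div_cancel₀ _ (h'.τ_pos n).ne', add_right_comm]
    congr 1
    rw [← Finset.add_sum_erase _ _ (Finset.mem_univ b),
      ← Finset.add_sum_erase (a := b) _ _ (Finset.mem_univ b), if_pos rfl, zero_smul, zero_add,
      add_comm]
    congr 1
    refine Finset.sum_congr rfl fun i hi => ?_
    rw [if_neg (Finset.ne_of_mem_erase hi), hb _ _ (Finset.ne_of_mem_erase hi), one_mul]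

variable [FiniteDimensional ℝ V]

/-- The cone is not a union of rays in a direction transverse to a flat and fixed by it. -/
theorem FlatFrame.e_not_mem (hQ : IsQuasiHomogeneous C K) (hirr : IsRayIrreducible C)
    (Fr : FlatFrame C ι) : Fr.e ∉ closure C := by
  classical
  intro he
  have hp : ∀ n : ℕ, ∑ i, (1 : ℝ) • Fr.w i + ((n : ℝ) + 1) • Fr.e ∈ C := fun n => by
    simp only [one_smul]
    exact hQ.add_smul_mem (by positivity) Fr.sum_mem he
  choose g hg hgK using fun n => hQ.exists_aut _ (hp n)
  have hn0 : ∀ n : ℕ, (0 : ℝ) < (n : ℝ) + 1 := fun n => by positivity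
  let w : ℕ → ι → V := fun n i => g n ((1 : ℝ) • Fr.w i)
  let e : ℕ → V := fun n => g n (((n : ℝ) + 1) • Fr.e)
  let ξ : ℕ → ι → V →L[ℝ] ℝ := fun n i => (1 : ℝ)⁻¹ • (Fr.ξ i).comp ((g n).symm : V →L[ℝ] V)
  let η : ℕ → V →L[ℝ] ℝ := fun n => ((n : ℝ) + 1)⁻¹ • Fr.η.comp ((g n).symm : V →L[ℝ] V)
  have hrec : ∀ n v, ∑ i, ξ n i v • w n i + η n v • e n = v := fun n v =>
    Fr.recon_conj (g n) (c := fun _ => 1) (fun _ => one_pos) (hn0 n) v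
  obtain ⟨B1, hB1, hb1⟩ := hQ.exists_sum_bound (ι := Option ι)
  obtain ⟨B2, hB2, hb2⟩ := hQ.exists_functional_bound
  have hbound : ∀ n (o : Option ι), ‖o.elim (e n) (w n)‖ ≤ B1 := by
    intro n
    refine hb1 _ ?_ ?_
    · rintro (_ | i)
      · exact (hg n).map_closure (hQ.smul_closure_mem (hn0 n) he)
      · exact (hg n).map_closure (by simpa using Fr.w_mem i)
    · have := hgK n
      rw [map_add, map_sum] at this
      rw [Fintype.sum_option, add_comm]
      exact this
  have hξpos : ∀ n i, ∀ v ∈ C, 0 < ξ n i v := fun n i v hv => by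
    simpa [ξ] using Fr.pos i _ (((hg n).symm v).2 hv)
  have hξb : ∀ n i, ‖ξ n i‖ ≤ B2 := by
    intro n i
    have := hb2 (ξ n i) (fun v hv => (hξpos n i v hv).le) _ (hgK n)
    have h1 := Fr.ξ_point (fun _ => 1) ((n : ℝ) + 1) i
    simp only [ξ, inv_one, one_smul, ContinuousLinearMap.comp_apply,
      ContinuousLinearEquiv.coe_coe, ContinuousLinearEquiv.symm_apply_apply] at this h1 ⊢
    rwa [h1, mul_one] at this
  obtain ⟨θ, m, hm, hθ⟩ := hQ.proper_closure
  have hθ0 : ∀ v ∈ closure C, 0 ≤ θ v := fun v hv => le_trans (by positivity) (hθ v hv)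
  have hθe : 0 < θ Fr.e := by
    have hne : Fr.e ≠ 0 := fun h0 => by simpa [h0] using Fr.η_e
    exact (mul_pos hm (norm_pos_iff.2 hne)).trans_le (hθ _ he)
  let T : ℕ → V →L[ℝ] ℝ := fun n => ((n : ℝ) + 1)⁻¹ • θ.comp ((g n).symm : V →L[ℝ] V)
  have hT0 : ∀ n, ∀ v ∈ C, 0 ≤ T n v := fun n v hv =>
    mul_nonneg (inv_nonneg.2 (hn0 n).le) (hθ0 _ (subset_closure (((hg n).symm v).2 hv)))
  have hTη : ∀ n v, η n v = (θ Fr.e)⁻¹ * (T n v - ((n : ℝ) + 1)⁻¹ * ∑ i, ξ n i v * θ (Fr.w i)) := by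
    intro n v
    have h1 := congrArg θ (Fr.recon ((g n).symm v))
    simp only [map_add, map_sum, map_smul, smul_eq_mul] at h1
    simp only [T, ξ, η, smul_apply, ContinuousLinearMap.comp_apply,
      ContinuousLinearEquiv.coe_coe, smul_eq_mul, inv_one, one_mul]
    rw [← h1]
    field_simp
    ring
  have hTb : ∀ n, ‖T n‖ ≤ B2 * (θ (∑ i, Fr.w i) + θ Fr.e) := by
    intro n
    refine (hb2 (T n) (hT0 n) _ (hgK n)).trans ?_
    gcongr
    simp only [T, smul_apply, ContinuousLinearMap.comp_apply,
      ContinuousLinearEquiv.coe_coe, smul_eq_mul, ContinuousLinearEquiv.symm_apply_apply,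
      one_smul, map_add, map_smul]
    rw [mul_inv_cancel_left₀ (hn0 n).ne']
    gcongr
    refine mul_le_of_le_one_left (hθ0 _ (subset_closure Fr.sum_mem)) ?_
    exact inv_le_one_of_one_le₀ (by simp)
  have hηb : ∀ n, ‖η n‖ ≤ (θ Fr.e)⁻¹ * (B2 * (θ (∑ i, Fr.w i) + θ Fr.e) +
      ∑ i, B2 * θ (Fr.w i)) := by
    intro n
    have hnn : 0 ≤ B2 * (θ (∑ i, Fr.w i) + θ Fr.e) + ∑ i, B2 * θ (Fr.w i) :=
      add_nonneg ((norm_nonneg _).trans (hTb n))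
        (Finset.sum_nonneg fun i _ => mul_nonneg hB2.le (hθ0 _ (Fr.w_mem i)))
    refine ContinuousLinearMap.opNorm_le_bound _ (by positivity) fun v => ?_
    rw [hTη, norm_mul, norm_inv, Real.norm_of_nonneg hθe.le, mul_assoc]
    gcongr
    rw [add_mul, Finset.sum_mul]
    refine (norm_sub_le _ _).trans (add_le_add ?_ ?_)
    · exact (T n).le_of_opNorm_le (hTb n) v
    · rw [norm_mul, norm_inv, Real.norm_of_nonneg (hn0 n).le]
      refine (mul_le_of_le_one_left (norm_nonneg _) (inv_le_one_of_one_le₀ (by simp))).trans ?_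
      refine (norm_sum_le _ _).trans (Finset.sum_le_sum fun i _ => ?_)
      rw [norm_mul, Real.norm_of_nonneg (hθ0 _ (Fr.w_mem i)), mul_right_comm]
      exact mul_le_mul_of_nonneg_right ((ξ n i).le_of_opNorm_le (hξb n i) v)
        (hθ0 _ (Fr.w_mem i))
  obtain ⟨φ, w', e', ξ', η', hφ, hlw, hle, hlξ, hlη⟩ := exists_subseq_basis
    (w := w) (e := e) (ξ := ξ) (η := η)
    (M := max (max B1 B2) ((θ Fr.e)⁻¹ * (B2 * (θ (∑ i, Fr.w i) + θ Fr.e) +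
      ∑ i, B2 * θ (Fr.w i))))
    (fun n i => (hbound n (some i)).trans (by simp)) (fun n => (hbound n none).trans (by simp))
    (fun n i => (hξb n i).trans (by simp)) (fun n => (hηb n).trans (le_max_right _ _))
  have hηe : η' e' = 1 := tendsto_const_eq (tendsto_clm_apply hlη hle) fun n => by
    simp [η, e, Fr.η_e, (hn0 (φ n)).ne']
  have hξe : ∀ i, ξ' i e' = 0 := fun i =>
    tendsto_const_eq (tendsto_clm_apply (hlξ i) hle) fun n => by simp [ξ, e, Fr.ξ_e]
  have hrec' : ∀ v, ∑ i, ξ' i v • w' i + η' v • e' = v := fun v =>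
    tendsto_const_eq ((tendsto_finsetSum Finset.univ fun i _ =>
        (tendsto_clm_apply (hlξ i) tendsto_const_nhds).smul (hlw i)).add
        ((tendsto_clm_apply hlη tendsto_const_nhds).smul hle)) fun n => hrec _ v
  have hrtop : Tendsto (fun n : ℕ => ((φ n : ℝ) + 1)) atTop atTop :=
    tendsto_atTop_add_const_right _ _ (tendsto_natCast_atTop_atTop.comp hφ.tendsto_atTop)
  have hηpos : ∀ v ∈ C, 0 < η' v := by
    refine hQ.pos_of_nonneg (fun h0 => by simp [h0] at hηe) fun v hv => ?_
    have h1 : Tendsto (fun n => -((θ Fr.e)⁻¹ * (((φ n : ℝ) + 1)⁻¹ *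
        ∑ i, ξ (φ n) i v * θ (Fr.w i)))) atTop (nhds (-((θ Fr.e)⁻¹ * (0 *
        ∑ i, ξ' i v * θ (Fr.w i))))) :=
      ((hrtop.inv_tendsto_atTop.mul (tendsto_finsetSum Finset.univ fun i _ =>
        (tendsto_clm_apply (hlξ i) tendsto_const_nhds).mul_const _)).const_mul _).neg
    rw [zero_mul, mul_zero, neg_zero] at h1
    refine le_of_tendsto_of_tendsto' h1 (tendsto_clm_apply hlη tendsto_const_nhds) fun n => ?_
    rw [hTη, mul_sub]
    have := mul_nonneg (inv_nonneg.2 hθe.le) (hT0 (φ n) v hv)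
    linarith
  refine hirr.false_of_degeneration hQ.toIsProperCone (fun n => hg (φ n)) (a := e') (a0 := Fr.e)
    (α := η') (Q := fun v => ∑ i, ξ' i v • Fr.w i) (r := fun n => (φ n : ℝ) + 1) he
    (fun n => hn0 _) hηe ?_ hηpos ?_ (Or.inl hrtop)
  · intro v s
    simp [hξe]
  · intro v
    have h1 : Tendsto (fun n => ∑ i, ξ' i v • w (φ n) i + η' v • e (φ n)) atTop (nhds v) := by
      have := (tendsto_finsetSum Finset.univ fun i _ => (hlw i).const_smul (ξ' i v)).add
        (hle.const_smul (η' v))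
      rwa [hrec'] at this
    refine h1.congr fun n => ?_
    simp only [w, e, map_add, map_sum, map_smul, smul_smul, one_smul]
    rw [mul_comm]

end Degeneration

section Supports

variable {V : Type*} [NormedAddCommGroup V] [NormedSpace ℝ V] {ι : Type*} [Fintype ι]
  {C K : Set V}

namespace FlatFrame

theorem point_mono (hC : IsProperCone C) (Fr : FlatFrame C ι) {c c' : ι → ℝ}
    (h : ∀ i, c i ≤ c' i) {t : ℝ} (hm : ∑ i, c i • Fr.w i + t • Fr.e ∈ C) :
    ∑ i, c' i • Fr.w i + t • Fr.e ∈ C := by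
  have := hC.add_sum_mem hm Fr.w_mem fun i => sub_nonneg.2 (h i)
  rwa [add_right_comm, ← Finset.sum_add_distrib, Finset.sum_congr rfl fun i _ => by
    rw [← add_smul, add_sub_cancel]] at this

theorem point_mono_closure (hC : IsProperCone C) (Fr : FlatFrame C ι) {c c' : ι → ℝ}
    (h : ∀ i, c i ≤ c' i) {t : ℝ} (hm : ∑ i, c i • Fr.w i + t • Fr.e ∈ closure C) :
    ∑ i, c' i • Fr.w i + t • Fr.e ∈ closure C := by
  have := hC.closure_add_sum_mem hm Fr.w_mem fun i => sub_nonneg.2 (h i)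
  rwa [add_right_comm, ← Finset.sum_add_distrib, Finset.sum_congr rfl fun i _ => by
    rw [← add_smul, add_sub_cancel]] at this

theorem smul_point (Fr : FlatFrame C ι) (s : ℝ) (c : ι → ℝ) (t : ℝ) :
    s • (∑ i, c i • Fr.w i + t • Fr.e) = ∑ i, (s * c i) • Fr.w i + (s * t) • Fr.e := by
  simp only [smul_add, Finset.smul_sum, smul_smul]

theorem exists_height_le (hC : IsProperCone C) (Fr : FlatFrame C ι) (he : Fr.e ∉ closure C) :
    ∃ H : ℝ, 0 < H ∧ ∀ t : ℝ, ∑ i, Fr.w i + t • Fr.e ∈ closure C → t ≤ H := by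
  have h : NormLim Fr Fr (fun _ _ => 1) (fun _ => 1) fun _ => ContinuousLinearEquiv.refl ℝ V :=
    { aut := fun _ _ => Iff.rfl
      c_pos := fun _ _ => one_pos
      τ_pos := fun _ => one_pos
      w_lim := fun i => tendsto_const_nhds.congr fun _ => by simp
      e_lim := tendsto_const_nhds.congr fun _ => by simp
      ξ_lim := fun i => tendsto_const_nhds.congr fun _ => by ext; simp
      η_lim := tendsto_const_nhds.congr fun _ => by ext; simp }
  obtain ⟨B, hB, hb⟩ := h.exists_height_bound hC he
  obtain ⟨n, hn⟩ := hb.exists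
  exact ⟨B, hB, fun t ht => by simpa using hn t (by simpa using ht)⟩

variable [FiniteDimensional ℝ V]

/-- Points of a supporting hyperplane `ξ b = 0` of the cone lie on the hyperplane of the flat. -/
theorem not_pos_of_facet (hQ : IsQuasiHomogeneous C K) (hirr : IsRayIrreducible C)
    (Fr : FlatFrame C ι) {b : ι} {z : V} (hz : z ∈ closure C) (hb : Fr.ξ b z = 0) :
    ¬ 0 < Fr.η z := by
  classical
  intro hy
  have hC := hQ.toIsProperCone
  obtain ⟨M, hM, hxM⟩ : ∃ M : ℝ, 0 < M ∧ ∀ i, Fr.ξ i z ≤ M := by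
    obtain ⟨i, hi⟩ := @Finite.exists_max _ _ _ ⟨b⟩ _ fun i => Fr.ξ i z
    exact ⟨max (Fr.ξ i z) 1, by positivity, fun j => (hi j).trans (le_max_left _ _)⟩
  let c : ℕ → ι → ℝ := fun n i => if i = b then 1 / ((n : ℝ) + 1) else 1
  have hcpos : ∀ n i, 0 < c n i := fun n i => by
    simp only [c]; split_ifs <;> positivity
  have hc1 : ∀ n i, c n i ≤ 1 := fun n i => by
    simp only [c]
    split_ifs
    · rw [div_le_one (by positivity)]; simp
    · exact le_rfl
  have hδ : ∀ n, ∑ i, c n i • Fr.w i + (M⁻¹ * Fr.η z) • Fr.e ∈ closure C := by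
    intro n
    have h1 := hC.smul_closure_mem (inv_pos.2 hM) hz
    rw [← Fr.recon z, smul_point] at h1
    refine Fr.point_mono_closure hC (fun i => ?_) h1
    by_cases hi : i = b
    · rw [hi, hb, mul_zero]; exact (hcpos n b).le
    · simp only [c, if_neg hi]
      rw [inv_mul_le_one₀ hM]
      exact hxM i
  obtain ⟨φ, hφ, τ, g, Fr', h⟩ := hQ.exists_normLim Fr c hcpos
  obtain ⟨B, hB, hb1⟩ := h.exists_height_bound hC (Fr'.e_not_mem hQ hirr)
  obtain ⟨y, hy0, hb2⟩ := h.exists_height_mem hC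
  obtain ⟨H, hH, hb3⟩ := Fr.exists_height_le hC (Fr.e_not_mem hQ hirr)
  refine h.false_of_bounded hC hirr b (fun n i hi => by simp [c, hi]) (Or.inr ?_)
    (lo := M⁻¹ * Fr.η z / B) (hi := H / y) (by positivity) ?_
  · simp only [c, if_true]
    exact tendsto_one_div_add_atTop_nhds_zero_nat.comp hφ.tendsto_atTop
  · filter_upwards [hb1, hb2] with n hn1 hn2
    constructor
    · rw [div_le_iff₀' hB]
      exact hn1 _ (hδ _)
    · rw [le_div_iff₀' hy0]
      refine hb3 _ (subset_closure ?_)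
      simpa using Fr.point_mono hC (c' := fun _ => 1) (hc1 (φ n)) hn2

/-- Any vector on the positive side of all the supporting hyperplanes of a flat is moved into
the cone by adding a large multiple of a ray of the flat. -/
theorem exists_add_smul_mem (hQ : IsQuasiHomogeneous C K) (hirr : IsRayIrreducible C)
    (Fr : FlatFrame C ι) {v : V} (hv : ∀ i, 0 < Fr.ξ i v) (j : ι) :
    ∃ r : ℝ, v + r • Fr.w j ∈ C := by
  classical
  wlog hη : 0 ≤ Fr.η v generalizing Fr
  · exact this Fr.neg hv (neg_nonneg.2 (not_le.1 hη).le)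
  by_contra! hno
  have hC := hQ.toIsProperCone
  obtain ⟨m, hm, hxm⟩ : ∃ m : ℝ, 0 < m ∧ ∀ i, m ≤ Fr.ξ i v := by
    obtain ⟨i, hi⟩ := @Finite.exists_min _ _ _ ⟨j⟩ _ fun i => Fr.ξ i v
    exact ⟨_, hv i, hi⟩
  let c : ℕ → ι → ℝ := fun n i => if i = j then (n : ℝ) + 1 else 1
  have hcpos : ∀ n i, 0 < c n i := fun n i => by
    simp only [c]; split_ifs <;> positivity
  have hc1 : ∀ n i, 1 ≤ c n i := fun n i => by
    simp only [c]
    split_ifs <;> simp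
  obtain ⟨δ, hδ, hδC⟩ := hC.exists_pos_smul_add_mem Fr.sum_mem Fr.e
  obtain ⟨φ, hφ, τ, g, Fr', h⟩ := hQ.exists_normLim Fr c hcpos
  obtain ⟨B, hB, hb1⟩ := h.exists_height_bound hC (Fr'.e_not_mem hQ hirr)
  obtain ⟨y, hy0, hb2⟩ := h.exists_height_mem hC
  refine h.false_of_bounded hC hirr j (fun n i hi => by simp [c, hi]) (Or.inl ?_)
    (lo := δ / B) (hi := m⁻¹ * Fr.η v / y) (by positivity) ?_
  · simp only [c, if_true]
    exact tendsto_atTop_add_const_right _ _ (tendsto_natCast_atTop_atTop.comp hφ.tendsto_atTop)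
  · filter_upwards [hb1, hb2] with n hn1 hn2
    constructor
    · rw [div_le_iff₀' hB]
      refine hn1 _ (subset_closure ?_)
      exact Fr.point_mono hC (c := fun _ => 1) (hc1 (φ n)) (by simpa using hδC)
    · rw [le_div_iff₀' hy0]
      by_contra! hlt
      have h1 := hC.add_smul_mem_of_lt (hC.sum_pos_mem Fr.w_mem Fr.sum_mem (h.c_pos n))
        (by positivity) hlt (subset_closure hn2)
      have h2 := hC.smul_mem m hm _ h1
      rw [smul_point, mul_inv_cancel_left₀ hm.ne'] at h2
      refine hno (m * c (φ n) j) ?_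
      have h3 := Fr.point_mono hC (c' := fun i => Fr.ξ i v + if i = j then m * c (φ n) j else 0)
        (fun i => ?_) h2
      · simp only [add_smul, Finset.sum_add_distrib, ite_smul, zero_smul, Finset.sum_ite_eq',
          Finset.mem_univ, if_true] at h3
        rwa [add_right_comm, Fr.recon] at h3
      · split_ifs with hi
        · rw [hi]; linarith [hv j]
        · simp only [c, if_neg hi]
          linarith [hxm i]

/-- A flat cannot lie in a tilted hyperplane passing through a ray of another flat. -/
theorem false_of_vanishing_slope (hQ : IsQuasiHomogeneous C K) (hirr : IsRayIrreducible C)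
    (hcard : Fintype.card ι + 1 = Module.finrank ℝ V) (h3 : 3 ≤ Fintype.card ι)
    (Fr : FlatFrame C ι) {w' : ι → V} (hw' : IsFlatTuple C w') {a : ι → ℝ} (ha : ∀ i, 0 ≤ a i)
    {j i₁ : ι} (hj : a j = 0) (hi₁ : 0 < a i₁)
    (hη : ∀ k, Fr.η (w' k) = ∑ i, a i * Fr.ξ i (w' k)) : False := by
  classical
  obtain ⟨Fr', rfl⟩ := hw'.exists_frame hQ.toIsProperCone hcard
  have hξ0 : ∀ i k, 0 ≤ Fr.ξ i (Fr'.w k) := fun i k => Fr.ξ_nonneg i (Fr'.w_mem k)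
  let ψ : V →L[ℝ] ℝ := Fr.η - ∑ i, a i • Fr.ξ i
  have hψ : ∀ v, ψ v = Fr.η v - ∑ i, a i * Fr.ξ i v := fun v => by
    simp [ψ]
  have hψw : ∀ k, ψ (Fr'.w k) = 0 := fun k => by rw [hψ, hη, sub_self]
  have hψj : ψ (Fr.w j) = 0 := by
    rw [hψ, Fr.η_w, Finset.sum_eq_single j, hj]
    · simp
    · intro i _ hi
      rw [Fr.ξ_ne i j hi, mul_zero]
    · simp
  have hwj := Fr'.eq_sum_of_η_eq_zero (Fr'.η_eq_zero_of_vanish hψw (u := Fr.e)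
    (by rw [hψ]; simp [Fr.η_e, Fr.ξ_e]) hψj)
  have hx0 : ∀ k, 0 ≤ Fr'.ξ k (Fr.w j) := fun k => Fr'.ξ_nonneg k (Fr.w_mem j)
  obtain ⟨k₀, hk₀⟩ : ∃ k, 0 < Fr'.ξ k (Fr.w j) := by
    by_contra! hall
    have h0 : Fr.w j = 0 := by
      rw [← hwj]
      exact Finset.sum_eq_zero fun k _ => by rw [le_antisymm (hall k) (hx0 k), zero_smul]
    simpa [h0] using Fr.ξ_self j
  have hk₀i : ∀ i, i ≠ j → Fr.ξ i (Fr'.w k₀) = 0 := by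
    intro i hi
    have h1 := congrArg (Fr.ξ i) hwj
    rw [Fr.ξ_ne i j hi, map_sum, Finset.sum_eq_zero_iff_of_nonneg] at h1
    · have h2 := h1 k₀ (Finset.mem_univ _)
      rw [map_smul, smul_eq_mul] at h2
      exact (mul_eq_zero.1 h2).resolve_left hk₀.ne'
    · intro k _
      rw [map_smul]
      exact mul_nonneg (hx0 k) (hξ0 i k)
  have hηk₀ : Fr.η (Fr'.w k₀) = 0 := by
    rw [hη]
    refine Finset.sum_eq_zero fun i _ => ?_
    by_cases hi : i = j
    · rw [hi, hj, zero_mul]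
    · rw [hk₀i i hi, mul_zero]
  have hwk₀ : Fr'.w k₀ = Fr.ξ j (Fr'.w k₀) • Fr.w j := by
    conv_lhs => rw [← Fr.eq_sum_of_η_eq_zero hηk₀]
    exact Finset.sum_eq_single j (fun i _ hi => by rw [hk₀i i hi, zero_smul]) (by simp)
  have hlam : Fr.ξ j (Fr'.w k₀) ≠ 0 := by
    intro h0
    rw [h0, zero_smul] at hwk₀
    simpa [hwk₀] using Fr'.ξ_self k₀
  have hfacet : ∀ k, k ≠ k₀ → ∃ i, ∀ l, l ≠ k → Fr.ξ i (Fr'.w l) = 0 := by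
    intro k hk
    by_contra! hall
    have hz : ∀ i, 0 < Fr.ξ i (∑ l ∈ Finset.univ.erase k, Fr'.w l) := by
      intro i
      obtain ⟨l, hl, hne⟩ := hall i
      rw [map_sum]
      exact Finset.sum_pos' (fun l _ => hξ0 i l)
        ⟨l, by simpa using hl, lt_of_le_of_ne (hξ0 i l) hne.symm⟩
    obtain ⟨r, hr⟩ := Fr.exists_add_smul_mem hQ hirr hz j
    have h1 := Fr'.pos k _ hr
    have h2 : Fr'.ξ k (Fr.w j) = 0 := by
      have := congrArg (Fr'.ξ k) hwk₀
      rw [Fr'.ξ_ne k k₀ hk, map_smul, smul_eq_mul] at this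
      exact (mul_eq_zero.1 this.symm).resolve_left hlam
    rw [map_add, map_smul, h2, smul_zero, add_zero, map_sum, Finset.sum_eq_zero] at h1
    · exact h1.false
    · intro l hl
      exact Fr'.ξ_ne k l (Finset.ne_of_mem_erase hl).symm
  obtain ⟨k₁, hk₁⟩ : ∃ k, 0 < Fr.η (Fr'.w k) := by
    by_contra! hall
    have h1 : ∑ k, Fr.η (Fr'.w k) ≤ 0 := Finset.sum_nonpos fun k _ => hall k
    have h2 : ∑ k, Fr.η (Fr'.w k) = ∑ i, a i * Fr.ξ i (∑ k, Fr'.w k) := by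
      simp only [hη, map_sum, Finset.mul_sum]
      exact Finset.sum_comm
    have h4 : 0 < ∑ i, a i * Fr.ξ i (∑ k, Fr'.w k) :=
      Finset.sum_pos' (fun i _ => mul_nonneg (ha i) (Fr.pos i _ Fr'.sum_mem).le)
        ⟨i₁, Finset.mem_univ _, mul_pos hi₁ (Fr.pos i₁ _ Fr'.sum_mem)⟩
    linarith
  have hk₁₀ : k₁ ≠ k₀ := fun h => by rw [h, hηk₀] at hk₁; exact hk₁.false
  obtain ⟨k₂, hk₂⟩ : ∃ k₂, k₂ ∉ ({k₀, k₁} : Finset ι) := by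
    by_contra! hall
    have := Finset.card_le_card (fun k _ => hall k : (Finset.univ : Finset ι) ⊆ {k₀, k₁})
    have h5 : ({k₀, k₁} : Finset ι).card ≤ 2 := Finset.card_le_two
    rw [Finset.card_univ] at this
    omega
  simp only [Finset.mem_insert, Finset.mem_singleton, not_or] at hk₂
  obtain ⟨i, hi⟩ := hfacet k₂ hk₂.1
  exact Fr.not_pos_of_facet hQ hirr (Fr'.w_mem k₁) (hi k₁ (Ne.symm hk₂.2)) hk₁

end FlatFrame

end Supports

section Isolation

variable {V : Type*} [NormedAddCommGroup V] [NormedSpace ℝ V] {ι : Type*} [Fintype ι]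
  {C K : Set V}

/-- The open simplicial cones spanned by two tuples have a common point. -/
def Meets (w w' : ι → V) : Prop :=
  ∃ c b : ι → ℝ, (∀ i, 0 < c i) ∧ (∀ i, 0 < b i) ∧ ∑ i, c i • w i = ∑ i, b i • w' i

theorem exists_pos_sum_mul_eq_zero {x : ι → ℝ} {i : ι} (hs : 0 ≤ ∑ j, x j) (hi : x i < 0) :
    ∃ c : ι → ℝ, (∀ j, 0 < c j) ∧ ∑ j, c j * x j = 0 := by
  classical
  refine ⟨fun j => 1 + if j = i then (∑ j, x j) / -x i else 0, fun j => ?_, ?_⟩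
  · have : 0 ≤ (∑ j, x j) / -x i := div_nonneg hs (neg_nonneg.2 hi.le)
    beta_reduce
    split_ifs <;> linarith
  · simp only [add_mul, one_mul, Finset.sum_add_distrib, ite_mul, zero_mul, Finset.sum_ite_eq',
      Finset.mem_univ, if_true]
    field_simp [hi.ne]
    ring

variable [FiniteDimensional ℝ V]

/-- Flats whose barycentres converge inside the cone subconverge to a flat. -/
theorem IsFlatTuple.exists_subseq (hC : IsProperCone C) {u : ℕ → ι → V} {s : V}
    (hu : ∀ n, IsFlatTuple C (u n)) (hs : s ∈ C)
    (hlim : Tendsto (fun n => ∑ i, u n i) atTop (nhds s)) :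
    ∃ (φ : ℕ → ℕ) (u' : ι → V), StrictMono φ ∧
      (∀ i, Tendsto (fun n => u (φ n) i) atTop (nhds (u' i))) ∧ IsFlatTuple C u' ∧
      ∑ i, u' i = s := by
  have : ProperSpace V := FiniteDimensional.proper ℝ V
  obtain ⟨θ, m, hm, hθ⟩ := hC.proper_closure
  have hθ0 : ∀ v ∈ closure C, 0 ≤ θ v := fun v hv => le_trans (by positivity) (hθ v hv)
  obtain ⟨M, hM⟩ := ((θ.continuous.tendsto _).comp hlim).bddAbove_range
  have hb : ∀ n i, ‖u n i‖ ≤ M / m := by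
    intro n i
    rw [le_div_iff₀' hm]
    refine (hθ _ ((hu n).mem_closure i)).trans (le_trans ?_ (hM ⟨n, rfl⟩))
    simp only [Function.comp, map_sum]
    exact Finset.single_le_sum (f := fun j => θ (u n j))
      (fun j _ => hθ0 _ ((hu n).mem_closure j)) (Finset.mem_univ i)
  have hmem : ∀ n, u n ∈ closedBall (0 : ι → V) (max (M / m) 0) := fun n => by
    rw [mem_closedBall_zero_iff, pi_norm_le_iff_of_nonneg (le_max_right _ _)]
    exact fun i => (hb n i).trans (le_max_left _ _)
  obtain ⟨u', -, φ, hφ, hlim'⟩ := tendsto_subseq_of_bounded isBounded_closedBall hmem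
  have hcomp := tendsto_pi_nhds.1 hlim'
  have hsum : ∑ i, u' i = s := tendsto_nhds_unique
    (tendsto_finsetSum Finset.univ fun i _ => hcomp i) (hlim.comp hφ.tendsto_atTop)
  exact ⟨φ, u', hφ, hcomp, IsFlatTuple.of_tendsto hC (fun n => hu (φ n)) hcomp (hsum ▸ hs), hsum⟩

namespace FlatFrame

/-- A flat disjoint from a given one lies in a hyperplane tilted to one side of it. -/
theorem exists_slope (hC : IsProperCone C) (hcard : Fintype.card ι + 1 = Module.finrank ℝ V)
    (Fr : FlatFrame C ι) {w' : ι → V} (hw' : IsFlatTuple C w') (hno : ¬ Meets Fr.w w') :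
    ∃ a : ι → ℝ, (∀ i, 0 ≤ a i) ∧ (∃ i, 0 < a i) ∧
      ((∀ k, Fr.η (w' k) = ∑ i, a i * Fr.ξ i (w' k)) ∨
        ∀ k, Fr.neg.η (w' k) = ∑ i, a i * Fr.neg.ξ i (w' k)) := by
  obtain ⟨Fr', rfl⟩ := hw'.exists_frame hC hcard
  have hne : ∀ c : ι → ℝ, (∀ i, 0 < c i) → ∑ i, c i * Fr'.η (Fr.w i) ≠ 0 := by
    intro c hc h0
    refine hno ⟨c, fun k => Fr'.ξ k (∑ i, c i • Fr.w i), hc, fun k => ?_, ?_⟩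
    · exact Fr'.pos k _ (hC.sum_pos_mem Fr.w_mem Fr.sum_mem hc)
    · exact (Fr'.eq_sum_of_η_eq_zero (by simpa using h0)).symm
  wlog hs : 0 ≤ ∑ i, Fr'.η (Fr.w i) generalizing Fr'
  · refine this Fr'.neg hw' hno (fun c hc h0 => hne c hc ?_) ?_
    · simpa [neg, Finset.sum_neg_distrib] using h0
    · simpa [neg, Finset.sum_neg_distrib] using (not_le.1 hs).le
  have hx : ∀ i, 0 ≤ Fr'.η (Fr.w i) := by
    intro i
    by_contra! hi
    obtain ⟨c, hc, h0⟩ := exists_pos_sum_mul_eq_zero hs hi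
    exact hne c hc h0
  obtain ⟨i₁, hi₁⟩ : ∃ i, 0 < Fr'.η (Fr.w i) := by
    by_contra! hall
    exact hne (fun _ => 1) (fun _ => one_pos)
      (Finset.sum_eq_zero fun i _ => by rw [le_antisymm (hall i) (hx i), mul_zero])
  have hexp : ∀ v, Fr'.η v = ∑ i, Fr.ξ i v * Fr'.η (Fr.w i) + Fr.η v * Fr'.η Fr.e := by
    intro v
    conv_lhs => rw [← Fr.recon v]
    simp
  have hzero : ∀ k, ∑ i, Fr.ξ i (Fr'.w k) * Fr'.η (Fr.w i) + Fr.η (Fr'.w k) * Fr'.η Fr.e = 0 :=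
    fun k => by rw [← hexp, Fr'.η_w]
  have he : Fr'.η Fr.e ≠ 0 := by
    intro h0
    have h1 := hexp (∑ k, Fr'.w k)
    rw [h0, mul_zero, add_zero, map_sum, Finset.sum_eq_zero fun k _ => Fr'.η_w k] at h1
    have h2 : 0 < ∑ i, Fr.ξ i (∑ k, Fr'.w k) * Fr'.η (Fr.w i) :=
      Finset.sum_pos' (fun i _ => mul_nonneg (Fr.pos i _ Fr'.sum_mem).le (hx i))
        ⟨i₁, Finset.mem_univ _, mul_pos (Fr.pos i₁ _ Fr'.sum_mem) hi₁⟩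
    linarith
  have hsum : ∀ k (t : ℝ), ∑ i, Fr'.η (Fr.w i) / t * Fr.ξ i (Fr'.w k) =
      -(Fr.η (Fr'.w k) * Fr'.η Fr.e) / t := by
    intro k t
    rw [← eq_neg_of_add_eq_zero_left (hzero k), Finset.sum_div]
    exact Finset.sum_congr rfl fun i _ => by ring
  rcases he.lt_or_gt with h | h
  · refine ⟨fun i => Fr'.η (Fr.w i) / -Fr'.η Fr.e, fun i => div_nonneg (hx i) (neg_pos.2 h).le,
      ⟨i₁, div_pos hi₁ (neg_pos.2 h)⟩, Or.inl fun k => ?_⟩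
    rw [hsum]
    field_simp
  · refine ⟨fun i => Fr'.η (Fr.w i) / Fr'.η Fr.e, fun i => div_nonneg (hx i) h.le,
      ⟨i₁, div_pos hi₁ h⟩, Or.inr fun k => ?_⟩
    change -Fr.η (Fr'.w k) = ∑ i, Fr'.η (Fr.w i) / Fr'.η Fr.e * Fr.ξ i (Fr'.w k)
    rw [hsum]
    field_simp

/-- Weights on a flat at which the cone is about as high as the hyperplane of slope `a`. -/
theorem exists_balanced_weights [DecidableEq ι] (hQ : IsQuasiHomogeneous C K)
    (hirr : IsRayIrreducible C) (Fr : FlatFrame C ι) {a : ι → ℝ} (ha : ∀ i, 0 < a i) {i₀ j : ι}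
    (hj : j ≠ i₀) {D : ℝ} (hD : 0 < D)
    (h0 : ∑ i, (1 / a i) • Fr.w i + (3 * (1 + D)) • Fr.e ∈ C) :
    ∃ r : ℝ, 1 ≤ r ∧ ∑ i, ((if i = i₀ then r else 1) / a i) • Fr.w i + (3 * (r + D)) • Fr.e ∈ C ∧
      ∑ i, ((if i = i₀ then r else 1) / a i) • Fr.w i + (6 * (r + D)) • Fr.e ∉ C := by
  have hC := hQ.toIsProperCone
  let P : ℕ → Prop := fun k =>
    ∑ i, ((if i = i₀ then (2 : ℝ) ^ k else 1) / a i) • Fr.w i + (3 * ((2 : ℝ) ^ k + D)) • Fr.e ∈ C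
  have hP0 : P 0 := by simpa [P] using h0
  have hex : ∃ k, ¬ P k := by
    by_contra! hall
    have h2 : Tendsto (fun k : ℕ => ((2 : ℝ) ^ k)⁻¹) atTop (nhds 0) :=
      (tendsto_pow_atTop_atTop_of_one_lt one_lt_two).inv_tendsto_atTop
    have h1 : Tendsto (fun k : ℕ => ∑ i, ((if i = i₀ then 1 else ((2 : ℝ) ^ k)⁻¹) / a i) • Fr.w i +
        (3 * (1 + ((2 : ℝ) ^ k)⁻¹ * D)) • Fr.e) atTop
        (nhds (∑ i, ((if i = i₀ then 1 else 0) / a i) • Fr.w i + (3 * (1 + 0 * D)) • Fr.e)) := by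
      refine (tendsto_finsetSum _ fun i _ => ?_).add ?_
      · refine Tendsto.smul_const (Tendsto.div_const ?_ _) _
        split_ifs
        exacts [tendsto_const_nhds, h2]
      · exact (((h2.mul_const D).const_add 1).const_mul 3).smul_const _
    have h3 : ∑ i, ((if i = i₀ then 1 else 0) / a i) • Fr.w i + (3 * (1 + 0 * D)) • Fr.e ∈
        closure C := by
      refine mem_closure_of_tendsto h1 (Eventually.of_forall fun k => ?_)
      have hk : (0 : ℝ) < 2 ^ k := by positivity
      have := hC.smul_mem _ (inv_pos.2 hk) _ (hall k)
      rw [smul_point] at this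
      convert this using 2
      · refine Finset.sum_congr rfl fun i _ => ?_
        split_ifs
        · rw [← mul_div_assoc, inv_mul_cancel₀ hk.ne']
        · rw [← mul_div_assoc, mul_one]
      · congr 1
        field_simp
    refine Fr.not_pos_of_facet hQ hirr h3 (b := j) ?_ ?_
    · rw [ξ_point, if_neg hj, zero_div]
    · rw [η_point]; norm_num
  classical
  have hk := Nat.find_spec hex
  have hmin := fun m => Nat.find_min hex (m := m)
  obtain ⟨k, hkk⟩ : ∃ k, Nat.find hex = k + 1 :=
    Nat.exists_eq_succ_of_ne_zero fun h => by rw [h] at hk; exact hk hP0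
  rw [hkk] at hk
  have hPk : P k := not_not.1 (hmin k (by omega))
  have hk1 : (1 : ℝ) ≤ 2 ^ k := one_le_pow₀ one_le_two
  refine ⟨2 ^ k, hk1, hPk, fun h6 => hk ?_⟩
  have hpos : ∀ i, 0 < (if i = i₀ then (2 : ℝ) ^ k else 1) / a i := fun i => by
    have := ha i
    split_ifs <;> positivity
  have h7 := hC.add_smul_mem_of_lt (h' := 3 * (2 ^ (k + 1) + D))
    (hC.sum_pos_mem Fr.w_mem Fr.sum_mem hpos) (by positivity) (by rw [pow_succ]; linarith)
    (subset_closure h6)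
  refine Fr.point_mono hC (fun i => ?_) h7
  refine div_le_div_of_nonneg_right ?_ (ha i).le
  split_ifs
  · exact pow_le_pow_right₀ one_le_two (Nat.le_succ k)
  · exact le_rfl

end FlatFrame

end Isolation

section SlopeLimit

variable {V : Type*} [NormedAddCommGroup V] [NormedSpace ℝ V] {ι : Type*} [Fintype ι]
  {C K : Set V} [FiniteDimensional ℝ V]

namespace FlatFrame

theorem sum_slope_mul_weights [DecidableEq ι] {a : ι → ℝ} (ha : ∀ i, 0 < a i) (i₀ : ι) (r : ℝ) :
    ∑ i, a i * ((if i = i₀ then r else 1) / a i) = r + ((Fintype.card ι : ℝ) - 1) := by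
  have h1 : ∀ i, a i * ((if i = i₀ then r else 1) / a i) = 1 + if i = i₀ then r - 1 else 0 := by
    intro i
    rw [mul_div_cancel₀ _ (ha i).ne']
    split_ifs <;> ring
  simp only [h1, Finset.sum_add_distrib, Finset.sum_ite_eq', Finset.mem_univ, if_true,
    Finset.sum_const, Finset.card_univ, nsmul_eq_mul, mul_one]
  ring

/-- Flats disjoint from a given one cannot have slopes tending to zero. -/
theorem false_of_slope_tendsto_zero (hQ : IsQuasiHomogeneous C K) (hirr : IsRayIrreducible C)
    (hcard : Fintype.card ι + 1 = Module.finrank ℝ V) (h3 : 3 ≤ Fintype.card ι)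
    (Fr : FlatFrame C ι) {w : ℕ → ι → V} (hw : ∀ n, IsFlatTuple C (w n)) {a : ℕ → ι → ℝ}
    (ha : ∀ n i, 0 ≤ a n i) (ha1 : ∀ n, ∃ i, 0 < a n i)
    (hlim : ∀ i, Tendsto (fun n => a n i) atTop (nhds 0))
    (hη : ∀ n k, Fr.η (w n k) = ∑ i, a n i * Fr.ξ i (w n k)) : False := by
  classical
  have hC := hQ.toIsProperCone
  have hapos : ∀ n i, 0 < a n i := by
    intro n j
    refine lt_of_le_of_ne (ha n j) fun h0 => ?_
    obtain ⟨i, hi⟩ := ha1 n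
    exact Fr.false_of_vanishing_slope hQ hirr hcard h3 (hw n) (ha n) h0.symm hi (hη n)
  obtain ⟨i₀, j, hj⟩ : ∃ i₀ j : ι, j ≠ i₀ := by
    obtain ⟨j, i₀, h⟩ := Fintype.exists_pair_of_one_lt_card (α := ι) (by omega)
    exact ⟨i₀, j, h⟩
  set D : ℝ := (Fintype.card ι : ℝ) - 1 with hDdef
  have hD : 0 < D := by
    have : (3 : ℝ) ≤ Fintype.card ι := by exact_mod_cast h3
    rw [hDdef]
    linarith
  obtain ⟨δ, hδ, hδC⟩ := hC.exists_pos_smul_add_mem Fr.sum_mem Fr.e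
  have hlarge : ∀ s : ℝ, 0 < s → ∀ᶠ n in atTop, ∀ i, s ≤ 1 / a n i := by
    intro s hs
    rw [eventually_all]
    intro i
    filter_upwards [(hlim i).eventually (eventually_lt_nhds (inv_pos.2 hs))] with n hn
    rw [le_div_iff₀ (hapos n i), ← le_div_iff₀' hs, one_div]
    exact hn.le
  have hlargeC : ∀ s : ℝ, 0 < s → ∀ᶠ n in atTop, ∀ c : ι → ℝ, (∀ i, 1 / a n i ≤ c i) →
      ∑ i, c i • Fr.w i + (s * δ) • Fr.e ∈ C := by
    intro s hs
    filter_upwards [hlarge s hs] with n hn c hc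
    have h1 := hC.smul_mem s hs (∑ i, (1 : ℝ) • Fr.w i + δ • Fr.e) (by simpa using hδC)
    rw [smul_point] at h1
    exact Fr.point_mono hC (fun i => by rw [mul_one]; exact (hn i).trans (hc i)) h1
  obtain ⟨N, hN⟩ := eventually_atTop.1 (hlargeC (3 * (1 + D) / δ) (by positivity))
  have hbal := fun n => Fr.exists_balanced_weights hQ hirr (hapos (n + N)) hj hD (by
    have := hN (n + N) (Nat.le_add_left _ _) _ fun i => le_rfl
    rwa [div_mul_cancel₀ _ hδ.ne'] at this)
  choose r hr1 hr3 hr6 using hbal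
  let c : ℕ → ι → ℝ := fun n i => (if i = i₀ then r n else 1) / a (n + N) i
  have hnum : ∀ n i, 1 ≤ (if i = i₀ then r n else 1) := fun n i => by
    split_ifs
    exacts [hr1 n, le_rfl]
  have hcpos : ∀ n i, 0 < c n i := fun n i =>
    div_pos (one_pos.trans_le (hnum n i)) (hapos _ i)
  obtain ⟨φ, hφ, τ, g, Fr', h⟩ := hQ.exists_normLim Fr c hcpos
  obtain ⟨B, hB, hb1⟩ := h.exists_height_bound hC (Fr'.e_not_mem hQ hirr)
  obtain ⟨y, hy0, hb2⟩ := h.exists_height_mem hC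
  have hsumC : ∀ n, ∑ i, c n i • Fr.w i ∈ C := fun n =>
    hC.sum_pos_mem Fr.w_mem Fr.sum_mem (hcpos n)
  have hℓ : ∀ n, 0 < r n + D := fun n => by linarith [hr1 n]
  have hIcc : ∀ᶠ n in atTop, (r (φ n) + D) / τ n ∈ Icc (y / 6) (B / 3) := by
    filter_upwards [hb1, hb2] with n hn1 hn2
    have hτ := h.τ_pos n
    constructor
    · rw [le_div_iff₀ hτ]
      by_contra! hlt
      exact hr6 (φ n) (hC.add_smul_mem_of_lt (hsumC _) (by linarith [hℓ (φ n)])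
        (by linarith) (subset_closure hn2))
    · rw [div_le_iff₀ hτ]
      linarith [hn1 _ (subset_closure (hr3 (φ n)))]
  have hτtop : Tendsto τ atTop atTop := by
    rw [Filter.tendsto_atTop]
    intro M
    have h1 := hlargeC (max M 1 * B / δ) (by positivity)
    have h2 := (tendsto_atTop_mono (fun n => Nat.le_add_right (φ n) N)
      hφ.tendsto_atTop).eventually h1
    filter_upwards [h2, hb1] with n hn hn1
    have h4 := hn1 _ (subset_closure (hn (c (φ n)) fun i =>
      div_le_div_of_nonneg_right (hnum _ i) (hapos _ i).le))
    rw [div_mul_cancel₀ _ hδ.ne', mul_comm B, mul_le_mul_iff_left₀ hB] at h4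
    exact (le_max_left _ _).trans h4
  obtain ⟨ρ, hρI, ψ, hψ, hρ⟩ := isCompact_Icc.tendsto_subseq' hIcc.frequently
  have hρ0 : 0 < ρ := lt_of_lt_of_le (by positivity) hρI.1
  have h' := h.comp hψ
  have hτ' : Tendsto (fun n => (τ (ψ n))⁻¹) atTop (nhds 0) :=
    (hτtop.comp hψ.tendsto_atTop).inv_tendsto_atTop
  let m : ℕ → ℕ := fun n => φ (ψ n)
  have hpt : ∀ t : ℝ, Tendsto (fun n => g (ψ n) (∑ i, c (m n) i • Fr.w i +
      (t * (r (m n) + D)) • Fr.e)) atTop (nhds (∑ i, Fr'.w i + (t * ρ) • Fr'.e)) := by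
    intro t
    have h1 := h'.point_lim (x := fun _ _ => 1) (x' := fun _ => 1) (fun i => tendsto_const_nhds)
      (hρ.const_mul t)
    simp only [one_smul, mul_one] at h1
    refine h1.congr fun n => ?_
    have : τ (ψ n) * (t * ((r (φ (ψ n)) + D) / τ (ψ n))) = t * (r (φ (ψ n)) + D) := by
      have := (h'.τ_pos n).ne'
      field_simp
    simp only [Function.comp, this, m]
  have hlimC : ∑ i, Fr'.w i + ρ • Fr'.e ∈ C := by
    refine hC.add_smul_mem_of_lt (h := 3 * ρ) Fr'.sum_mem hρ0.le (by linarith) ?_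
    exact mem_closure_of_tendsto (hpt 3) (Eventually.of_forall fun n =>
      (h'.aut n _).2 (hr3 _))
  have hz : ∀ n, ∃ β : ι → ℝ, (∀ k, 0 < β k) ∧
      ∑ k, β k • w (n + N) k = ∑ i, c n i • Fr.w i + (1 * (r n + D)) • Fr.e := by
    intro n
    have hzC : ∑ i, c n i • Fr.w i + (1 * (r n + D)) • Fr.e ∈ C :=
      hC.add_smul_mem_of_lt (hsumC n) (by linarith [hℓ n]) (by linarith [hℓ n])
        (subset_closure (hr3 n))
    obtain ⟨F, hF⟩ := (hw (n + N)).exists_frame hC hcard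
    let χ : V →L[ℝ] ℝ := Fr.η - ∑ i, a (n + N) i • Fr.ξ i
    have hχ : ∀ v, χ v = Fr.η v - ∑ i, a (n + N) i * Fr.ξ i v := fun v => by simp [χ]
    have h0 : F.η (∑ i, c n i • Fr.w i + (1 * (r n + D)) • Fr.e) = 0 := by
      refine F.η_eq_zero_of_vanish (φ := χ) (fun k => ?_) (u := Fr.e) ?_ ?_
      · rw [hχ, hF, hη, sub_self]
      · rw [hχ]; simp [Fr.η_e, Fr.ξ_e]
      · rw [hχ, η_point, Finset.sum_congr rfl fun i _ => by rw [ξ_point],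
          sum_slope_mul_weights (hapos (n + N)), one_mul, sub_self]
    refine ⟨fun k => F.ξ k _, fun k => F.pos k _ hzC, ?_⟩
    rw [← hF]
    exact F.eq_sum_of_η_eq_zero h0
  choose β hβ hβs using hz
  let u : ℕ → ι → V := fun n k => g (ψ n) (β (m n) k • w (m n + N) k)
  have huflat : ∀ n, IsFlatTuple C (u n) := fun n =>
    ((hw (m n + N)).smul (hβ (m n))).map (h'.aut n)
  have husum : Tendsto (fun n => ∑ k, u n k) atTop (nhds (∑ i, Fr'.w i + ρ • Fr'.e)) := by
    have h1 := hpt 1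
    rw [one_mul] at h1
    refine h1.congr fun n => ?_
    rw [← hβs, map_sum]
  obtain ⟨κ, u', hκ, hu', hu'flat, -⟩ := IsFlatTuple.exists_subseq hC huflat hlimC husum
  have hrτ : Tendsto (fun n => r (m n) / τ (ψ n)) atTop (nhds ρ) := by
    have := hρ.sub (hτ'.const_mul D)
    rw [mul_zero, sub_zero] at this
    refine this.congr fun n => ?_
    simp only [Function.comp, m]
    ring
  have hslope : ∀ k, Fr'.η (u' k) = ∑ i, (if i = i₀ then ρ else 0) * Fr'.ξ i (u' k) := by
    intro k
    have h1 := tendsto_clm_apply (h'.η_lim.comp hκ.tendsto_atTop) (hu' k)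
    have h2 : ∀ i, Tendsto (fun n => (if i = i₀ then r (m (κ n)) / τ (ψ (κ n)) else
        (τ (ψ (κ n)))⁻¹) * ((c (m (κ n)) i)⁻¹ • (Fr.ξ i).comp
          ((g (ψ (κ n))).symm : V →L[ℝ] V)) (u (κ n) k)) atTop
        (nhds ((if i = i₀ then ρ else 0) * Fr'.ξ i (u' k))) := by
      intro i
      refine Tendsto.mul ?_ (tendsto_clm_apply ((h'.ξ_lim i).comp hκ.tendsto_atTop) (hu' k))
      split_ifs
      exacts [hrτ.comp hκ.tendsto_atTop, hτ'.comp hκ.tendsto_atTop]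
    refine tendsto_nhds_unique h1 ((tendsto_finsetSum Finset.univ fun i _ => h2 i).congr
      fun n => ?_)
    simp only [u, Function.comp, smul_apply, ContinuousLinearMap.comp_apply,
      ContinuousLinearEquiv.coe_coe, ContinuousLinearEquiv.symm_apply_apply, map_smul,
      smul_eq_mul, hη, Finset.mul_sum]
    refine Finset.sum_congr rfl fun i _ => ?_
    have h5 : (c (m (κ n)) i)⁻¹ * (if i = i₀ then r (m (κ n)) / τ (ψ (κ n)) else
        (τ (ψ (κ n)))⁻¹) = a (m (κ n) + N) i * (τ (ψ (κ n)))⁻¹ := by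
      have h6 := (hapos (m (κ n) + N) i).ne'
      have h7 := (one_pos.trans_le (hr1 (m (κ n)))).ne'
      have h8 := (h'.τ_pos (κ n)).ne'
      simp only [c]
      split_ifs <;> field_simp
    linear_combination (β (m (κ n)) k * Fr.ξ i (w (m (κ n) + N) k)) * h5
  exact Fr'.false_of_vanishing_slope hQ hirr hcard h3 hu'flat
    (a := fun i => if i = i₀ then ρ else 0) (j := j) (i₁ := i₀)
    (fun i => by split_ifs; exacts [hρ0.le, le_rfl]) (by simp [hj]) (by simpa using hρ0) hslope

end FlatFrame

/-- Flats close to a given flat meet it. -/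
theorem FlatFrame.eventually_meets (hQ : IsQuasiHomogeneous C K) (hirr : IsRayIrreducible C)
    (hcard : Fintype.card ι + 1 = Module.finrank ℝ V) (h3 : 3 ≤ Fintype.card ι)
    (Fr : FlatFrame C ι) {w : ℕ → ι → V} (hw : ∀ n, IsFlatTuple C (w n))
    (hlim : ∀ k, Tendsto (fun n => w n k) atTop (nhds (Fr.w k))) :
    ∀ᶠ n in atTop, Meets Fr.w (w n) := by
  have key : ∀ (Fr' : FlatFrame C ι), Fr'.w = Fr.w → ∀ φ : ℕ → ℕ, Tendsto φ atTop atTop →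
      (∀ n, ∃ a : ι → ℝ, (∀ i, 0 ≤ a i) ∧ (∃ i, 0 < a i) ∧
        ∀ k, Fr'.η (w (φ n) k) = ∑ i, a i * Fr'.ξ i (w (φ n) k)) → False := by
    intro Fr' hFr' φ hφ hex
    choose a ha ha1 hη using hex
    have hlim' : Tendsto (fun n => ∑ k, w (φ n) k) atTop (nhds (∑ k, Fr'.w k)) :=
      tendsto_finsetSum _ fun k _ => hFr' ▸ (hlim k).comp hφ
    have hη0 : Tendsto (fun n => Fr'.η (∑ k, w (φ n) k)) atTop (nhds 0) := by
      have := (Fr'.η.continuous.tendsto _).comp hlim'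
      rwa [map_sum, Finset.sum_eq_zero fun k _ => Fr'.η_w k] at this
    have hsum : ∀ n, Fr'.η (∑ k, w (φ n) k) = ∑ i, a n i * Fr'.ξ i (∑ k, w (φ n) k) := by
      intro n
      simp only [hη, map_sum, Finset.mul_sum]
      exact Finset.sum_comm
    refine Fr'.false_of_slope_tendsto_zero hQ hirr hcard h3 (fun n => hw (φ n)) ha ha1
      (fun i => ?_) hη
    have hξ1 : ∀ᶠ n in atTop, 1 / 2 < Fr'.ξ i (∑ k, w (φ n) k) := by
      refine ((Fr'.ξ i).continuous.tendsto _ |>.comp hlim').eventually (lt_mem_nhds ?_)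
      have := Fr'.ξ_sum (fun _ => 1) i
      simp only [one_smul] at this
      rw [this]
      norm_num
    have h2 := hη0.const_mul 2
    rw [mul_zero] at h2
    refine squeeze_zero' (Eventually.of_forall fun n => ha n i) ?_ h2
    filter_upwards [hξ1] with n hn
    have h4 : a n i * Fr'.ξ i (∑ k, w (φ n) k) ≤ Fr'.η (∑ k, w (φ n) k) := by
      rw [hsum]
      exact Finset.single_le_sum (f := fun i => a n i * Fr'.ξ i (∑ k, w (φ n) k))
        (fun j _ => mul_nonneg (ha n j) (Fr'.pos j _ (hw (φ n)).sum_mem).le) (Finset.mem_univ i)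
    nlinarith [ha n i]
  by_contra hno
  rw [not_eventually] at hno
  have hsl := hno.mono fun n hn => Fr.exists_slope hQ.toIsProperCone hcard (hw n) hn
  have hor : (∃ᶠ n in atTop, ∃ a : ι → ℝ, (∀ i, 0 ≤ a i) ∧ (∃ i, 0 < a i) ∧
        ∀ k, Fr.η (w n k) = ∑ i, a i * Fr.ξ i (w n k)) ∨
      ∃ᶠ n in atTop, ∃ a : ι → ℝ, (∀ i, 0 ≤ a i) ∧ (∃ i, 0 < a i) ∧
        ∀ k, Fr.neg.η (w n k) = ∑ i, a i * Fr.neg.ξ i (w n k) := by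
    rw [← frequently_or_distrib]
    refine hsl.mono ?_
    rintro n ⟨a, h1, h2, h | h⟩
    exacts [Or.inl ⟨a, h1, h2, h⟩, Or.inr ⟨a, h1, h2, h⟩]
  rcases hor with h | h
  · obtain ⟨φ, hφ, h⟩ := extraction_of_frequently_atTop h
    exact key Fr rfl φ hφ.tendsto_atTop h
  · obtain ⟨φ, hφ, h⟩ := extraction_of_frequently_atTop h
    exact key Fr.neg rfl φ hφ.tendsto_atTop h

end SlopeLimit

section RelativeDensity

variable {V : Type*} [NormedAddCommGroup V] [NormedSpace ℝ V] {ι : Type*} [Fintype ι]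
  {C K : Set V}

/-- Two flats with the same span have the same rays. -/
theorem FlatFrame.eq_smul_of_pos (Fr Fr' : FlatFrame C ι) (hη : ∀ k, Fr'.η (Fr.w k) = 0)
    {j k : ι} (h : 0 < Fr.ξ k (Fr'.w j)) : Fr'.w j = Fr.ξ k (Fr'.w j) • Fr.w k := by
  classical
  have hη' : ∀ i, Fr.η (Fr'.w i) = 0 := fun i =>
    Fr.η_eq_zero_of_vanish hη (u := Fr'.e) (by simp [Fr'.η_e]) (Fr'.η_w i)
  have hA : ∀ i, ∑ l, Fr.ξ l (Fr'.w i) • Fr.w l = Fr'.w i := fun i => Fr.eq_sum_of_η_eq_zero (hη' i)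
  have hB : ∀ l, ∑ i, Fr'.ξ i (Fr.w l) • Fr'.w i = Fr.w l := fun l => Fr'.eq_sum_of_η_eq_zero (hη l)
  have hA0 : ∀ i l, 0 ≤ Fr.ξ l (Fr'.w i) := fun i l => Fr.ξ_nonneg l (Fr'.w_mem i)
  have hB0 : ∀ l i, 0 ≤ Fr'.ξ i (Fr.w l) := fun l i => Fr'.ξ_nonneg i (Fr.w_mem l)
  have hBA : ∀ m l, m ≠ l → ∀ i, Fr'.ξ i (Fr.w m) * Fr.ξ l (Fr'.w i) = 0 := by
    intro m l hml i
    have h1 := congrArg (Fr.ξ l) (hB m)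
    rw [Fr.ξ_ne l m hml.symm, map_sum] at h1
    simp only [map_smul, smul_eq_mul] at h1
    exact (Finset.sum_eq_zero_iff_of_nonneg fun i _ => mul_nonneg (hB0 m i) (hA0 i l)).1 h1 i
      (Finset.mem_univ i)
  have hBj : ∀ m, m ≠ k → Fr'.ξ j (Fr.w m) = 0 := fun m hm =>
    (mul_eq_zero.1 (hBA m k hm j)).resolve_right h.ne'
  have hkj : Fr'.ξ j (Fr.w k) ≠ 0 := by
    intro h0
    have h1 := congrArg (Fr'.ξ j) (hA j)
    rw [Fr'.ξ_self, map_sum] at h1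
    rw [Finset.sum_eq_zero fun m _ => ?_] at h1
    · exact zero_ne_one h1
    · rw [map_smul]
      by_cases hm : m = k
      · rw [hm, h0, smul_zero]
      · rw [hBj m hm, smul_zero]
  conv_lhs => rw [← hA j]
  refine Finset.sum_eq_single k (fun l _ hl => ?_) (by simp)
  rw [(mul_eq_zero.1 (hBA k l hl.symm j)).resolve_left hkj, zero_smul]

/-- Every flat crossing the flat with rays `w` lies in its span. -/
def IsUncrossed (C : Set V) (w : ι → V) : Prop :=
  ∀ w' : ι → V, IsFlatTuple C w' → Meets w w' → ∀ k, ∃ c : ι → ℝ, ∑ i, c i • w i = w' k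

variable [FiniteDimensional ℝ V]

/-- The stabiliser of an uncrossed flat acts on it with relatively dense orbits. -/
theorem IsQuasiHomogeneous.exists_relatively_dense (hQ : IsQuasiHomogeneous C K)
    (hirr : IsRayIrreducible C) (hcard : Fintype.card ι + 1 = Module.finrank ℝ V)
    (h3 : 3 ≤ Fintype.card ι) {Γ : Subgroup (V ≃ₗ[ℝ] V)}
    (hΓ : ∀ γ ∈ Γ, ∀ v, γ v ∈ C ↔ v ∈ C) (hcov : ∀ v ∈ C, ∃ γ ∈ Γ, ∃ s : ℝ, 0 < s ∧ s • γ v ∈ K)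
    {w : ι → V} (hw : IsFlatTuple C w) (hun : IsUncrossed C w) :
    ∃ R : ℝ, ∀ x : ι → ℝ, ∃ γ ∈ Γ, ∃ (l : ι → ℝ) (t : ℝ),
      (∀ i, γ (w i) = Real.exp (l i) • w i) ∧ ∀ i, |x i + t - l i| ≤ R := by
  have hC := hQ.toIsProperCone
  by_contra! hcon
  choose x hx using fun n : ℕ => hcon n
  choose γ hγ s hs hsK using fun n =>
    hcov (∑ i, Real.exp (x n i) • w i) ((hw _).2 fun i => Real.exp_pos _)
  have hmap : ∀ g ∈ Γ, ∀ {w' : ι → V}, IsFlatTuple C w' → IsFlatTuple C fun i => g (w' i) :=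
    fun g hg w' h => h.map (g := g.toContinuousLinearEquiv) (hΓ g hg)
  have hc : ∀ n i, 0 < s n * Real.exp (x n i) := fun n i => mul_pos (hs n) (Real.exp_pos _)
  let u : ℕ → ι → V := fun n i => (s n * Real.exp (x n i)) • γ n (w i)
  have hu : ∀ n, IsFlatTuple C (u n) := fun n => (hmap (γ n) (hγ n) hw).smul (hc n)
  have hsum : ∀ n, ∑ i, u n i ∈ K := by
    intro n
    convert hsK n using 1
    simp [u, map_sum, Finset.smul_sum, mul_smul]
  obtain ⟨k, hk, φ, hφ, hlim⟩ := hQ.isCompact.tendsto_subseq hsum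
  obtain ⟨ψ, u', hψ, hlim', hu', -⟩ :=
    IsFlatTuple.exists_subseq hC (fun n => hu (φ n)) (hQ.subset hk) hlim
  obtain ⟨Fr, rfl⟩ := hu'.exists_frame hC hcard
  have hev := Fr.eventually_meets hQ hirr hcard h3 (fun n => hu (φ (ψ n))) hlim'
  have hratio : ∀ j, Tendsto (fun n => Fr.ξ j (u (φ (ψ n)) j)) atTop (nhds 1) := by
    intro j
    have := ((Fr.ξ j).continuous.tendsto _).comp (hlim' j)
    rwa [Fr.ξ_self] at this
  have hev2 : ∀ᶠ n in atTop, ∀ j, Fr.ξ j (u (φ (ψ n)) j) ∈ Ioo (1 / 2 : ℝ) 2 :=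
    eventually_all.2 fun j => (hratio j).eventually (Ioo_mem_nhds (by norm_num) (by norm_num))
  have hpar : ∀ᶠ n in atTop, ∀ j, ∃ a : ℝ, a ∈ Ioo (1 / 2 : ℝ) 2 ∧ u (φ (ψ n)) j = a • Fr.w j := by
    filter_upwards [hev, hev2] with n hn hn2 j
    refine ⟨_, hn2 j, ?_⟩
    set m := φ (ψ n)
    obtain ⟨Fr', hFr'⟩ := (hu m).exists_frame hC hcard
    have hinv : IsFlatTuple C fun i => (γ m).symm (Fr.w i) := hmap (γ m)⁻¹ (inv_mem (hγ m)) hu'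
    have hmeet : Meets w fun i => (γ m).symm (Fr.w i) := by
      obtain ⟨c, b, hc', hb, h⟩ := hn
      refine ⟨fun i => b i * (s m * Real.exp (x m i)), c, fun i => mul_pos (hb i) (hc m i), hc', ?_⟩
      have := congrArg (γ m).symm h
      simpa [u, map_sum, mul_smul] using this.symm
    have hη : ∀ k, Fr'.η (Fr.w k) = 0 := by
      intro k
      obtain ⟨c, hck⟩ := hun _ hinv hmeet k
      have h1 : Fr.w k = ∑ i, (c i / (s m * Real.exp (x m i))) • Fr'.w i := by
        have := congrArg (γ m) hck
        rw [LinearEquiv.apply_symm_apply, map_sum] at this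
        rw [← this, hFr']
        refine Finset.sum_congr rfl fun i _ => ?_
        rw [map_smul, smul_smul, div_mul_cancel₀ _ (hc m i).ne']
      rw [h1, Fr'.η_sum]
    have := Fr.eq_smul_of_pos Fr' hη (j := j) (k := j) (by rw [hFr']; linarith [(hn2 j).1])
    rwa [hFr'] at this
  obtain ⟨N, hN⟩ := eventually_atTop.1 hpar
  choose a ha hua using hN
  set M := φ (ψ N)
  let y : ι → ℝ := fun j => Real.log (a N le_rfl j) - Real.log (s M) - x M j
  obtain ⟨n, hn⟩ := exists_nat_ge (max (N : ℝ) (1 + ∑ j, |y j|))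
  have hNn : N ≤ n := by exact_mod_cast (le_max_left _ _).trans hn
  have hnφ : n ≤ φ (ψ n) := (hψ.id_le n).trans (hφ.id_le _)
  have hapos : ∀ n hn j, 0 < a n hn j := fun n hn j => by linarith [(ha n hn j).1]
  set m := φ (ψ n) with hm
  obtain ⟨i, hi⟩ := hx m ((γ m)⁻¹ * γ M) (mul_mem (inv_mem (hγ m)) (hγ M))
    (fun j => y j + x m j + Real.log (s m) - Real.log (a n hNn j)) (Real.log (s m)) fun j => by
      change (γ m).symm (γ M (w j)) = _
      rw [LinearEquiv.symm_apply_eq, map_smul]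
      have h1 : γ M (w j) = (a N le_rfl j / (s M * Real.exp (x M j))) • Fr.w j := by
        rw [div_eq_inv_mul, mul_smul, ← hua N le_rfl j, smul_smul,
          inv_mul_cancel₀ (hc M j).ne', one_smul]
      have h2 : γ m (w j) = (a n hNn j / (s m * Real.exp (x m j))) • Fr.w j := by
        rw [div_eq_inv_mul, mul_smul, ← hua n hNn j, smul_smul,
          inv_mul_cancel₀ (hc m j).ne', one_smul]
      rw [h1, h2, smul_smul]
      congr 1
      simp only [y, Real.exp_sub, Real.exp_add, Real.exp_log (hs _), Real.exp_log (hapos _ _ _)]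
      have := (hapos n hNn j).ne'
      have := (hs m).ne'
      have := (hs M).ne'
      have := (Real.exp_pos (x m j)).ne'
      have := (Real.exp_pos (x M j)).ne'
      field_simp
  have h1 : |Real.log (a n hNn i)| ≤ 1 := by
    have h2 := Real.log_two_lt_d9
    rw [abs_le]
    constructor
    · have := Real.log_le_log (by norm_num) (ha n hNn i).1.le
      rw [one_div, Real.log_inv] at this
      linarith
    · have := Real.log_le_log (hapos n hNn i) (ha n hNn i).2.le
      linarith
  have h2 : |y i| ≤ ∑ j, |y j| :=
    Finset.single_le_sum (f := fun j => |y j|) (fun j _ => abs_nonneg _) (Finset.mem_univ i)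
  have h3 : (m : ℝ) < |Real.log (a n hNn i) - y i| := by
    have h4 : x m i + Real.log (s m) - (y i + x m i + Real.log (s m) - Real.log (a n hNn i)) =
        Real.log (a n hNn i) - y i := by ring
    rwa [h4] at hi
  have h4 := abs_sub (Real.log (a n hNn i)) (y i)
  have h5 := (le_max_right _ _).trans hn
  have h6 : (n : ℝ) ≤ m := by exact_mod_cast hnφ
  linarith

end RelativeDensity

section Lattices

/-- A group with a discrete, relatively dense image in a vector space is free abelian of full
rank. -/
theorem nonempty_mulEquiv_of_lattice {G E : Type*} [Group G] [NormedAddCommGroup E]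
    [NormedSpace ℝ E] [FiniteDimensional ℝ E] (L : Additive G →+ E) (hinj : Function.Injective L)
    (hfin : {g | ‖L g‖ ≤ 1}.Finite) {R : ℝ} (hdense : ∀ x, ∃ g, ‖x - L g‖ ≤ R) :
    Nonempty (G ≃* Multiplicative (Fin (Module.finrank ℝ E) → ℤ)) := by
  let Λ : Submodule ℤ E := AddSubgroup.toIntSubmodule L.range
  have hmem : ∀ g, L g ∈ Λ := fun g => ⟨g, rfl⟩
  have hdisc : DiscreteTopology Λ := by
    refine discreteTopology_of_isOpen_singleton_zero
      (isOpen_singleton_of_finite_mem_nhds 0 (closedBall_mem_nhds _ one_pos) ?_)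
    refine Set.Finite.of_finite_image ((hfin.image L).subset ?_)
      (Set.injOn_of_injective Subtype.val_injective)
    rintro _ ⟨⟨_, g, rfl⟩, hx, rfl⟩
    refine ⟨g, ?_, rfl⟩
    simpa using hx
  have hlat : IsZLattice ℝ Λ := by
    refine ⟨?_⟩
    by_contra hne
    obtain ⟨f, hf, hle⟩ := Submodule.exists_le_ker_of_lt_top _ (lt_top_iff_ne_top.2 hne)
    refine hf (LinearMap.ext fun x => ?_)
    have hb : ∀ y, |f y| ≤ ‖f.toContinuousLinearMap‖ * R := by
      intro y
      obtain ⟨g, hg⟩ := hdense y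
      have h0 : f (L g) = 0 := hle (Submodule.subset_span (hmem g))
      have h1 := f.toContinuousLinearMap.le_opNorm (y - L g)
      have h2 : f.toContinuousLinearMap (y - L g) = f y := by simp [h0]
      rw [h2, Real.norm_eq_abs] at h1
      exact h1.trans (mul_le_mul_of_nonneg_left hg (norm_nonneg _))
    by_contra hx
    obtain ⟨n, hn⟩ := exists_nat_gt (‖f.toContinuousLinearMap‖ * R / |f x|)
    have h1 := hb ((n : ℝ) • x)
    rw [div_lt_iff₀ (abs_pos.2 hx)] at hn
    rw [map_smul, smul_eq_mul, abs_mul, Nat.abs_cast] at h1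
    linarith
  have hfree := ZLattice.module_free ℝ Λ
  have hfinite := ZLattice.module_finite ℝ Λ
  let b := Module.finBasisOfFinrankEq ℤ Λ (ZLattice.rank ℝ Λ)
  let e : Additive G ≃+ (Fin (Module.finrank ℝ E) → ℤ) :=
    (AddMonoidHom.ofInjective hinj).trans b.equivFun.toAddEquiv
  exact ⟨AddEquiv.toMultiplicativeRight e⟩

end Lattices

section Stabilizer

variable {V : Type*} [NormedAddCommGroup V] [NormedSpace ℝ V] {ι : Type*} [Fintype ι]
  {C K : Set V}

/-- The elements of `Γ` preserving the rays spanned by the vectors `w i`. -/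
def rayStabilizer (Γ : Subgroup (V ≃ₗ[ℝ] V)) (w : ι → V) : Subgroup (V ≃ₗ[ℝ] V) where
  carrier := {γ | γ ∈ Γ ∧ ∀ i, ∃ l : ℝ, γ (w i) = Real.exp l • w i}
  mul_mem' := by
    rintro γ δ ⟨hγ, hγw⟩ ⟨hδ, hδw⟩
    refine ⟨mul_mem hγ hδ, fun i => ?_⟩
    obtain ⟨l, hl⟩ := hγw i
    obtain ⟨m, hm⟩ := hδw i
    refine ⟨m + l, ?_⟩
    rw [LinearEquiv.mul_apply, hm, map_smul, hl, smul_smul, Real.exp_add]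
  one_mem' := ⟨one_mem _, fun i => ⟨0, by simp⟩⟩
  inv_mem' := by
    rintro γ ⟨hγ, hγw⟩
    refine ⟨inv_mem hγ, fun i => ?_⟩
    obtain ⟨l, hl⟩ := hγw i
    refine ⟨-l, ?_⟩
    change γ.symm (w i) = _
    rw [LinearEquiv.symm_apply_eq, map_smul, hl, smul_smul, ← Real.exp_add, neg_add_cancel,
      Real.exp_zero, one_smul]

/-- The stabiliser of the rays of a flat is free abelian when its orbits are relatively dense. -/
theorem FlatFrame.nonempty_rayStabilizer_mulEquiv [Nonempty ι] (hC : IsProperCone C)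
    (Fr : FlatFrame C ι) {Γ : Subgroup (V ≃ₗ[ℝ] V)}
    (hfree : ∀ γ ∈ Γ, ∀ v ∈ C, ∀ s : ℝ, γ v = s • v → γ = 1)
    (hpd : ∀ K' : Set V, K' ⊆ C → IsCompact K' →
      {γ | γ ∈ Γ ∧ ∃ v ∈ K', ∃ s : ℝ, s • γ v ∈ K'}.Finite)
    {R : ℝ} (hdense : ∀ x : ι → ℝ, ∃ γ ∈ Γ, ∃ (l : ι → ℝ) (t : ℝ),
      (∀ i, γ (Fr.w i) = Real.exp (l i) • Fr.w i) ∧ ∀ i, |x i + t - l i| ≤ R) :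
    Nonempty (rayStabilizer Γ Fr.w ≃* Multiplicative (Fin (Fintype.card ι - 1) → ℤ)) := by
  classical
  obtain ⟨i₀⟩ := ‹Nonempty ι›
  choose l hl using fun (γ : rayStabilizer Γ Fr.w) i => γ.2.2 i
  have hw0 : ∀ i, Fr.w i ≠ 0 := fun i h0 => by simpa [h0] using Fr.ξ_self i
  have huniq : ∀ (γ : rayStabilizer Γ Fr.w) i (m : ℝ), γ.1 (Fr.w i) = Real.exp m • Fr.w i →
      l γ i = m := fun γ i m hm =>
    Real.exp_injective (smul_left_injective ℝ (hw0 i) ((hl γ i).symm.trans hm))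
  let L : Additive (rayStabilizer Γ Fr.w) →+ ({i // i ≠ i₀} → ℝ) :=
    AddMonoidHom.mk' (fun γ i => l γ.toMul i - l γ.toMul i₀) fun γ δ => by
      have hadd : ∀ i, l (γ + δ).toMul i = l γ.toMul i + l δ.toMul i := fun i => by
        refine huniq _ i _ ?_
        change γ.toMul.1 (δ.toMul.1 (Fr.w i)) = _
        rw [hl, map_smul, hl, smul_smul, add_comm, Real.exp_add]
      ext i
      simp only [hadd, Pi.add_apply]
      ring
  have hL : ∀ γ i, L γ i = l γ.toMul i - l γ.toMul i₀ := fun γ i => rfl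
  have hpt : ∀ γ : Additive (rayStabilizer Γ Fr.w),
      γ.toMul.1 (∑ i, Fr.w i) =
        Real.exp (l γ.toMul i₀) • ∑ i, Real.exp (l γ.toMul i - l γ.toMul i₀) • Fr.w i := by
    intro γ
    rw [map_sum, Finset.smul_sum]
    refine Finset.sum_congr rfl fun i _ => ?_
    rw [hl, smul_smul, ← Real.exp_add, add_sub_cancel]
  have hcard : Module.finrank ℝ ({i // i ≠ i₀} → ℝ) = Fintype.card ι - 1 := by
    rw [Module.finrank_fintype_fun_eq_card, Fintype.card_subtype_compl, Fintype.card_subtype_eq]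
  rw [← hcard]
  refine nonempty_mulEquiv_of_lattice L ((injective_iff_map_eq_zero L).2 fun γ hγ => ?_) ?_
    (R := 2 * R) fun x => ?_
  · have h1 : ∀ i, l γ.toMul i - l γ.toMul i₀ = 0 := fun i => by
      by_cases hi : i = i₀
      · rw [hi, sub_self]
      · exact congrFun hγ ⟨i, hi⟩
    have h2 := hpt γ
    simp only [h1, Real.exp_zero, one_smul] at h2
    have h3 := hfree _ γ.toMul.2.1 _ Fr.sum_mem _ h2
    exact congrArg Additive.ofMul (Subtype.ext h3 : γ.toMul = 1)
  · let K' : Set V := (fun z : ι → ℝ => ∑ i, Real.exp (z i) • Fr.w i) '' closedBall 0 1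
    have hK' : IsCompact K' := by
      refine (isCompact_closedBall _ _).image ?_
      fun_prop
    have hK'C : K' ⊆ C := by
      rintro _ ⟨z, -, rfl⟩
      exact hC.sum_pos_mem Fr.w_mem Fr.sum_mem fun i => Real.exp_pos _
    refine Set.Finite.of_finite_image ((hpd K' hK'C hK').subset ?_)
      (f := fun γ => γ.toMul.1) (Set.injOn_of_injective fun γ δ h => Subtype.ext h)
    rintro _ ⟨γ, hγ, rfl⟩
    refine ⟨γ.toMul.2.1, ∑ i, Fr.w i, ⟨0, by simp, by simp⟩, Real.exp (-l γ.toMul i₀),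
      fun i => l γ.toMul i - l γ.toMul i₀, ?_, ?_⟩
    · rw [mem_closedBall_zero_iff, pi_norm_le_iff_of_nonneg zero_le_one]
      intro i
      by_cases hi : i = i₀
      · simp [hi]
      · exact (norm_le_pi_norm (L γ) ⟨i, hi⟩).trans hγ
    · rw [hpt, smul_smul, ← Real.exp_add, neg_add_cancel, Real.exp_zero, one_smul]
  · obtain ⟨γ, hγ, m, t, hm, hR⟩ := hdense fun i => if h : i ≠ i₀ then x ⟨i, h⟩ else 0
    let γ' : rayStabilizer Γ Fr.w := ⟨γ, hγ, fun i => ⟨m i, hm i⟩⟩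
    have hlm : ∀ i, l γ' i = m i := fun i => huniq γ' i _ (hm i)
    have h0 := hR i₀
    rw [dif_neg (by simp)] at h0
    refine ⟨Additive.ofMul γ', ?_⟩
    rw [pi_norm_le_iff_of_nonneg (by linarith [(abs_nonneg _).trans h0])]
    rintro ⟨i, hi⟩
    have h1 := hR i
    rw [dif_pos hi] at h1
    rw [Pi.sub_apply, hL, toMul_ofMul, hlm, hlm, Real.norm_eq_abs]
    rw [abs_le] at h0 h1 ⊢
    constructor <;> linarith [h0.1, h0.2, h1.1, h1.2]

/-- The elements permuting finitely many rays lie in finitely many cosets of the stabiliser of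
these rays. -/
theorem exists_finset_rayStabilizer (Γ : Subgroup (V ≃ₗ[ℝ] V)) (w : ι → V) :
    ∃ T : Finset (V ≃ₗ[ℝ] V), ∀ γ ∈ Γ,
      (∀ i, ∃ (j : ι) (a : ℝ), 0 < a ∧ γ (w i) = a • w j) →
        ∃ t ∈ T, ∃ h ∈ rayStabilizer Γ w, γ = t * h := by
  classical
  let P : (ι → ι) → (V ≃ₗ[ℝ] V) → Prop := fun σ γ =>
    γ ∈ Γ ∧ ∀ i, ∃ a : ℝ, 0 < a ∧ γ (w i) = a • w (σ i)
  let rep : (ι → ι) → (V ≃ₗ[ℝ] V) := fun σ => if h : ∃ γ, P σ γ then h.choose else 1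
  refine ⟨Finset.univ.image rep, fun γ hγ hperm => ?_⟩
  choose σ a ha hγw using hperm
  have hex : ∃ γ, P σ γ := ⟨γ, hγ, fun i => ⟨a i, ha i, hγw i⟩⟩
  have hrep : P σ (rep σ) := by
    simp only [rep, dif_pos hex]
    exact hex.choose_spec
  refine ⟨rep σ, Finset.mem_image_of_mem _ (Finset.mem_univ _), (rep σ)⁻¹ * γ,
    ⟨mul_mem (inv_mem hrep.1) hγ, fun i => ?_⟩, by group⟩
  obtain ⟨b, hb, hbw⟩ := hrep.2 i
  refine ⟨Real.log (a i / b), ?_⟩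
  change (rep σ).symm (γ (w i)) = _
  rw [LinearEquiv.symm_apply_eq, map_smul, hbw, hγw, smul_smul,
    Real.exp_log (div_pos (ha i) hb), div_mul_cancel₀ _ hb.ne']

end Stabilizer

section IntrinsicInterior

theorem AffineIndependent.linearIndependent_prodMk_one {ι E : Type*} [Fintype ι] [AddCommGroup E]
    [Module ℝ E] {v : ι → E} (hv : AffineIndependent ℝ v) :
    LinearIndependent ℝ fun i => (v i, (1 : ℝ)) := by
  rw [Fintype.linearIndependent_iff]
  intro c hc i
  have h1 := congrArg Prod.fst hc
  have h2 := congrArg Prod.snd hc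
  simp only [Prod.fst_sum, Prod.snd_sum, Prod.smul_mk, smul_eq_mul, mul_one, Prod.fst_zero,
    Prod.snd_zero] at h1 h2
  exact affineIndependent_iff.1 hv Finset.univ c h2 h1 i (Finset.mem_univ i)

theorem LinearIndependent.exists_dual {ι E : Type*} [NormedAddCommGroup E]
    [NormedSpace ℝ E] [FiniteDimensional ℝ E] {v : ι → E} (hv : LinearIndependent ℝ v) (i : ι) :
    ∃ ξ : E →L[ℝ] ℝ, ξ (v i) = 1 ∧ ∀ j, j ≠ i → ξ (v j) = 0 := by
  classical
  obtain ⟨f, hf⟩ := LinearMap.exists_extend (p := Submodule.span ℝ (range v))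
    ((Finsupp.lapply i).comp (hv.repr : _ →ₗ[ℝ] _))
  have hval : ∀ j, f (v j) = (Finsupp.single j (1 : ℝ)) i := by
    intro j
    have h1 := LinearMap.congr_fun hf ⟨v j, Submodule.subset_span ⟨j, rfl⟩⟩
    rw [LinearMap.comp_apply, Submodule.subtype_apply] at h1
    rw [h1, LinearMap.comp_apply]
    change (hv.repr _) i = _
    rw [hv.repr_eq_single j _ rfl]
  refine ⟨f.toContinuousLinearMap, ?_, fun j hj => ?_⟩
  · simpa using hval i
  · simpa [Finsupp.single_apply, hj] using hval j

/-- Barycentric description of the open simplex with affinely independent vertices. -/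
theorem AffineIndependent.mem_intrinsicInterior_convexHull {ι E : Type*} [Fintype ι]
    [NormedAddCommGroup E] [NormedSpace ℝ E] [FiniteDimensional ℝ E] {v : ι → E}
    (hv : AffineIndependent ℝ v) {x : E} :
    x ∈ intrinsicInterior ℝ (convexHull ℝ (range v)) ↔
      ∃ c : ι → ℝ, (∀ i, 0 < c i) ∧ ∑ i, c i = 1 ∧ ∑ i, c i • v i = x := by
  choose ξ hξ1 hξ0 using hv.linearIndependent_prodMk_one.exists_dual
  have hξ : ∀ (c : ι → ℝ), ∑ i, c i = 1 → ∀ i, ξ i (∑ j, c j • v j, 1) = c i := by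
    intro c hc i
    have h1 : ((∑ j, c j • v j, 1) : E × ℝ) = ∑ j, c j • (v j, (1 : ℝ)) := by
      ext
      · simp [Prod.fst_sum]
      · simp [Prod.snd_sum, hc]
    rw [h1, map_sum, Finset.sum_eq_single i]
    · rw [map_smul, hξ1, smul_eq_mul, mul_one]
    · intro j _ hj
      rw [map_smul, hξ0 i j hj, smul_zero]
    · simp
  have hhull : ∀ y : E, y ∈ convexHull ℝ (range v) ↔
      ∃ c : ι → ℝ, (∀ i, 0 ≤ c i) ∧ ∑ i, c i = 1 ∧ ∑ i, c i • v i = y := by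
    intro y
    constructor
    · intro hy
      rw [convexHull_range_eq_exists_affineCombination] at hy
      obtain ⟨s, c, hc0, hc1, rfl⟩ := hy
      classical
      refine ⟨fun i => if i ∈ s then c i else 0, fun i => ?_, ?_, ?_⟩
      · beta_reduce
        split_ifs with h
        exacts [hc0 i h, le_rfl]
      · simpa using hc1
      · rw [Finset.affineCombination_eq_linear_combination _ _ _ hc1]
        simp [ite_smul]
    · rintro ⟨c, hc0, hc1, rfl⟩
      exact (convex_convexHull ℝ _).sum_mem (fun i _ => hc0 i) hc1
        fun i _ => subset_convexHull ℝ _ ⟨i, rfl⟩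
  have haff : ∀ y : affineSpan ℝ (convexHull ℝ (range v)),
      ∃ c : ι → ℝ, ∑ i, c i = 1 ∧ ∑ i, c i • v i = y := by
    rintro ⟨y, hy⟩
    rw [affineSpan_convexHull] at hy
    obtain ⟨c, hc, rfl⟩ := eq_affineCombination_of_mem_affineSpan_of_fintype hy
    exact ⟨c, hc, (Finset.affineCombination_eq_linear_combination _ _ _ hc).symm⟩
  rw [mem_intrinsicInterior]
  constructor
  · rintro ⟨y, hy, rfl⟩
    obtain ⟨c, hc, hcy⟩ := haff y
    refine ⟨c, fun i => ?_, hc, hcy⟩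
    by_contra! hi
    have hvi : v i ∈ affineSpan ℝ (convexHull ℝ (range v)) :=
      subset_affineSpan ℝ _ (subset_convexHull ℝ _ ⟨i, rfl⟩)
    let p : ℝ → affineSpan ℝ (convexHull ℝ (range v)) := fun t =>
      ⟨AffineMap.lineMap (v i) (y : E) t, AffineMap.lineMap_mem t hvi y.2⟩
    have hp : Continuous p := by
      refine Continuous.subtype_mk ?_ _
      exact AffineMap.lineMap_continuous
    have hp1 : p 1 = y := Subtype.ext (AffineMap.lineMap_apply_one _ _)
    have hnear : ∀ᶠ t in nhds (1 : ℝ), p t ∈ interior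
        (((↑) : affineSpan ℝ (convexHull ℝ (range v)) → E) ⁻¹' convexHull ℝ (range v)) :=
      hp.continuousAt.eventually (by rw [hp1]; exact isOpen_interior.mem_nhds hy)
    obtain ⟨t, ht, ht1⟩ := ((hnear.filter_mono nhdsWithin_le_nhds).and
      (self_mem_nhdsWithin (s := Ioi (1 : ℝ)))).exists
    obtain ⟨b, hb0, hb1, hbt⟩ := (hhull (p t)).1 (show p t ∈ _ from interior_subset ht)
    have h1 := hξ b hb1 i
    have h2 := hξ c hc i
    rw [hcy] at h2
    have h3 : ((p t : E), (1 : ℝ)) = (1 - t) • (v i, (1 : ℝ)) + t • ((y : E), (1 : ℝ)) := by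
      ext
      · simp [p, AffineMap.lineMap_apply_module]
      · simp
    rw [hbt, h3, map_add, map_smul, map_smul, hξ1, h2, smul_eq_mul, smul_eq_mul] at h1
    have h4 : (1 : ℝ) < t := ht1
    nlinarith [hb0 i]
  · rintro ⟨c, hc0, hc1, rfl⟩
    have hmem : ∑ i, c i • v i ∈ convexHull ℝ (range v) :=
      (hhull _).2 ⟨c, fun i => (hc0 i).le, hc1, rfl⟩
    refine ⟨⟨_, subset_affineSpan ℝ _ hmem⟩, ?_, rfl⟩
    rw [mem_interior]
    refine ⟨⋂ i, {y | 0 < ξ i ((y : E), (1 : ℝ))}, ?_, ?_, ?_⟩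
    · intro y hy
      obtain ⟨b, hb, hby⟩ := haff y
      refine (hhull _).2 ⟨b, fun i => ?_, hb, hby⟩
      have := mem_iInter.1 hy i
      rw [mem_ofPred_eq, ← hby, hξ b hb] at this
      exact this.le
    · exact isOpen_iInter_of_finite fun i => isOpen_lt continuous_const (by fun_prop)
    · refine mem_iInter.2 fun i => ?_
      rw [mem_ofPred_eq, hξ c hc1]
      exact hc0 i

end IntrinsicInterior

section ConeOver

variable {d : ℕ} {Ω : Set (Euc d)}

/-- The point of affine space on the line through `p`. -/
def dehom {d : ℕ} (p : Euc d × ℝ) : Euc d := p.2⁻¹ • p.1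

theorem smul_dehom {p : Euc d × ℝ} (hp : p.2 ≠ 0) : p.2 • (dehom p, (1 : ℝ)) = p := by
  ext1
  · simp [dehom, smul_smul, hp]
  · simp

theorem dehom_smul {s : ℝ} (hs : s ≠ 0) (p : Euc d × ℝ) : dehom (s • p) = dehom p := by
  simp only [dehom, Prod.smul_snd, Prod.smul_fst, smul_smul, smul_eq_mul]
  congr 1
  field_simp

theorem mem_coneOver_iff {p : Euc d × ℝ} : p ∈ coneOver Ω ↔ 0 < p.2 ∧ dehom p ∈ Ω := by
  constructor
  · rintro ⟨t, ht, x, hx, rfl⟩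
    rw [dehom_smul ht.ne']
    simpa [dehom, ht] using hx
  · rintro ⟨h, hx⟩
    exact ⟨p.2, h, _, hx, (smul_dehom h.ne').symm⟩

theorem mk_one_mem_coneOver {x : Euc d} : (x, (1 : ℝ)) ∈ coneOver Ω ↔ x ∈ Ω := by
  rw [mem_coneOver_iff]
  simp [dehom]

theorem smul_mem_coneOver {t : ℝ} (ht : 0 < t) {p : Euc d × ℝ} :
    t • p ∈ coneOver Ω ↔ p ∈ coneOver Ω := by
  rw [mem_coneOver_iff, mem_coneOver_iff, dehom_smul ht.ne', Prod.smul_snd, smul_eq_mul,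
    mul_pos_iff_of_pos_left ht]

theorem continuousAt_dehom {p : Euc d × ℝ} (hp : p.2 ≠ 0) : ContinuousAt dehom p :=
  (continuous_snd.continuousAt.inv₀ hp).smul continuous_fst.continuousAt

theorem exists_norm_fst_le (hbd : Bornology.IsBounded Ω) :
    ∃ B : ℝ, 0 < B ∧ ∀ p ∈ closure (coneOver Ω), ‖p.1‖ ≤ B * p.2 := by
  obtain ⟨B, hB0, hB⟩ := hbd.exists_pos_norm_le
  refine ⟨B, hB0, fun p hp => ?_⟩
  have hclosed : IsClosed {p : Euc d × ℝ | ‖p.1‖ ≤ B * p.2} :=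
    isClosed_le (by fun_prop) (by fun_prop)
  refine closure_minimal ?_ hclosed hp
  rintro _ ⟨t, ht, x, hx, rfl⟩
  simp only [mem_ofPred_eq, Prod.smul_fst, Prod.smul_snd, norm_smul, Real.norm_eq_abs,
    abs_of_pos ht, smul_eq_mul, mul_one]
  rw [mul_comm B]
  exact mul_le_mul_of_nonneg_left (hB x hx) ht.le

theorem snd_pos_of_mem_closure (hbd : Bornology.IsBounded Ω) {p : Euc d × ℝ}
    (hp : p ∈ closure (coneOver Ω)) (h0 : p ≠ 0) : 0 < p.2 := by
  obtain ⟨B, hB0, hB⟩ := exists_norm_fst_le hbd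
  have h1 := hB p hp
  by_contra! h2
  have h3 : p.2 = 0 := le_antisymm h2 (by
    by_contra! h
    nlinarith [norm_nonneg p.1])
  rw [h3, mul_zero, norm_le_zero_iff] at h1
  exact h0 (Prod.ext h1 h3)

theorem dehom_mem_closure {p : Euc d × ℝ} (hp : p ∈ closure (coneOver Ω)) (h0 : p.2 ≠ 0) :
    dehom p ∈ closure Ω :=
  closure_mono (image_subset_iff.2 fun _ hq => (mem_coneOver_iff.1 hq).2)
    (mem_closure_image (continuousAt_dehom h0) hp)

theorem mk_one_mem_closure_coneOver {x : Euc d} (hx : x ∈ closure Ω) :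
    (x, (1 : ℝ)) ∈ closure (coneOver Ω) := by
  have h : Continuous fun x : Euc d => (x, (1 : ℝ)) := by fun_prop
  refine closure_mono ?_ (image_closure_subset_closure_image h ⟨x, hx, rfl⟩)
  rintro _ ⟨y, hy, rfl⟩
  exact mk_one_mem_coneOver.2 hy

theorem isProperCone_coneOver (hbd : Bornology.IsBounded Ω) (hop : IsOpen Ω)
    (hconv : Convex ℝ Ω) : IsProperCone (coneOver Ω) where
  isOpen := by
    rw [isOpen_iff_mem_nhds]
    intro p hp
    rw [mem_coneOver_iff] at hp
    have h1 : ∀ᶠ q : Euc d × ℝ in nhds p, 0 < q.2 :=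
      continuous_snd.continuousAt.eventually (lt_mem_nhds hp.1)
    filter_upwards [h1, (continuousAt_dehom hp.1.ne').eventually (hop.mem_nhds hp.2)] with q h2 h3
    exact mem_coneOver_iff.2 ⟨h2, h3⟩
  convex := by
    rw [convex_iff_forall_pos]
    rintro _ ⟨s, hs, x, hx, rfl⟩ _ ⟨t, ht, y, hy, rfl⟩ a b ha hb -
    have hsum : 0 < a * s + b * t := by positivity
    refine ⟨a * s + b * t, hsum, (a * s / (a * s + b * t)) • x + (b * t / (a * s + b * t)) • y,
      hconv hx hy (by positivity) (by positivity) (by rw [← add_div, div_self hsum.ne']), ?_⟩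
    ext1
    · simp only [Prod.fst_add, Prod.smul_fst, smul_add, smul_smul, mul_div_cancel₀ _ hsum.ne']
    · simp
  smul_mem t ht v hv := (smul_mem_coneOver ht).2 hv
  proper := by
    obtain ⟨B, hB0, hB⟩ := exists_norm_fst_le hbd
    refine ⟨ContinuousLinearMap.snd ℝ _ _, (B + 1)⁻¹, by positivity, fun p hp => ?_⟩
    have h1 := hB p (subset_closure hp)
    have h2 := (mem_coneOver_iff.1 hp).1
    rw [inv_mul_le_iff₀ (by positivity), ContinuousLinearMap.coe_snd', Prod.norm_def,
      max_le_iff, Real.norm_eq_abs, abs_of_pos h2]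
    constructor <;> nlinarith

/-- An irreducible domain of positive dimension has a cone that does not split off a ray. -/
theorem IsIrreducibleDomain.isRayIrreducible (hirr : IsIrreducibleDomain Ω)
    (hC : IsProperCone (coneOver Ω)) (hd : 0 < d) : IsRayIrreducible (coneOver Ω) := by
  intro a α ha hα hcyl
  have ha0 : a ≠ 0 := by
    rintro rfl
    simp at ha
  have hcompl : IsCompl (Submodule.span ℝ {a}) (LinearMap.ker (α : Euc d × ℝ →ₗ[ℝ] ℝ)) := by
    rw [isCompl_iff, Submodule.disjoint_def, Submodule.codisjoint_iff_exists_add_eq]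
    constructor
    · intro x hx hx0
      obtain ⟨t, rfl⟩ := Submodule.mem_span_singleton.1 hx
      have : t = 0 := by simpa [ha] using hx0
      rw [this, zero_smul]
    · intro x
      exact ⟨α x • a, x - α x • a, Submodule.mem_span_singleton.2 ⟨_, rfl⟩, by simp [ha], by abel⟩
  have hspan : Submodule.span ℝ {a} ≠ ⊤ := by
    intro h
    have h1 := finrank_span_singleton (K := ℝ) ha0
    rw [h, finrank_top, Module.finrank_prod, finrank_euclideanSpace_fin, Module.finrank_self] at h1
    omega
  have hker : LinearMap.ker (α : Euc d × ℝ →ₗ[ℝ] ℝ) ≠ ⊤ := by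
    intro h
    have h1 : a ∈ LinearMap.ker (α : Euc d × ℝ →ₗ[ℝ] ℝ) := by rw [h]; trivial
    simp [ha] at h1
  let P : Euc d × ℝ →ₗ[ℝ] Euc d × ℝ := LinearMap.id - (α : Euc d × ℝ →ₗ[ℝ] ℝ).smulRight a
  have hP : ∀ v, P v = v - α v • a := fun v => rfl
  refine hirr ⟨Submodule.span ℝ {a}, LinearMap.ker (α : Euc d × ℝ →ₗ[ℝ] ℝ),
    {p | ∃ t : ℝ, 0 < t ∧ p = t • a}, P '' coneOver Ω, ?_, ?_, hspan, hker, hcompl, ?_, ?_, ?_,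
    hC.convex.linear_image P, ?_, ?_, ?_⟩
  · rwa [Ne, Submodule.span_singleton_eq_bot]
  · intro h
    rw [h] at hcompl
    exact hspan (eq_top_of_isCompl_bot hcompl)
  · rintro _ ⟨t, -, rfl⟩
    exact Submodule.mem_span_singleton.2 ⟨t, rfl⟩
  · rintro _ ⟨v, -, rfl⟩
    simp [hP, ha]
  · rw [convex_iff_forall_pos]
    rintro _ ⟨s, hs, rfl⟩ _ ⟨t, ht, rfl⟩ b c hb hc -
    exact ⟨b * s + c * t, by positivity, by simp only [smul_smul, add_smul]⟩
  · rintro t ht _ ⟨s, hs, rfl⟩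
    exact ⟨t * s, mul_pos ht hs, smul_smul _ _ _⟩
  · rintro t ht _ ⟨v, hv, rfl⟩
    exact ⟨t • v, hC.smul_mem t ht v hv, map_smul P t v⟩
  · ext p
    constructor
    · intro hp
      exact ⟨α p • a, ⟨_, hα p hp, rfl⟩, P p, ⟨p, hp, rfl⟩, by rw [hP]; abel⟩
    · rintro ⟨_, ⟨t, ht, rfl⟩, _, ⟨v, hv, rfl⟩, rfl⟩
      have h1 := hcyl v hv (t - α v) (by linarith)
      rwa [sub_smul, add_sub_left_comm] at h1

end ConeOver

section FlatsOfDomain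

variable {d : ℕ} {Ω : Set (Euc d)}

/-- The open simplex whose cone is spanned by the vectors `w i`. -/
def openSimplex (w : Fin d → Euc d × ℝ) : Set (Euc d) :=
  {x | ∃ c : Fin d → ℝ, (∀ i, 0 < c i) ∧ ∑ i, c i • w i = (x, 1)}

theorem sum_smul_mk_one (c : Fin d → ℝ) (v : Fin d → Euc d) :
    ∑ i, c i • (v i, (1 : ℝ)) = (∑ i, c i • v i, ∑ i, c i) := by
  ext1
  · simp [Prod.fst_sum]
  · simp [Prod.snd_sum]

theorem intrinsicInterior_eq_openSimplex {v : Fin d → Euc d} (hv : AffineIndependent ℝ v) :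
    intrinsicInterior ℝ (convexHull ℝ (range v)) = openSimplex fun i => (v i, 1) := by
  ext x
  rw [hv.mem_intrinsicInterior_convexHull]
  simp only [openSimplex, mem_ofPred_eq, sum_smul_mk_one, Prod.mk.injEq]
  exact exists_congr fun c => and_congr_right fun _ => and_comm

theorem openSimplex_smul {w : Fin d → Euc d × ℝ} {s : Fin d → ℝ} (hs : ∀ i, 0 < s i) :
    openSimplex (fun i => s i • w i) = openSimplex w := by
  ext x
  constructor
  · rintro ⟨c, hc, h⟩
    refine ⟨fun i => c i * s i, fun i => mul_pos (hc i) (hs i), ?_⟩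
    simpa only [smul_smul] using h
  · rintro ⟨c, hc, h⟩
    refine ⟨fun i => c i / s i, fun i => div_pos (hc i) (hs i), ?_⟩
    simpa only [smul_smul, div_mul_cancel₀ _ (hs _).ne'] using h

theorem dehom_sum_mem_openSimplex {w : Fin d → Euc d × ℝ} {c : Fin d → ℝ} (hc : ∀ i, 0 < c i)
    (hpos : 0 < (∑ i, c i • w i).2) : dehom (∑ i, c i • w i) ∈ openSimplex w := by
  refine ⟨fun i => (∑ i, c i • w i).2⁻¹ * c i, fun i => mul_pos (inv_pos.2 hpos) (hc i), ?_⟩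
  simp only [mul_smul, ← Finset.smul_sum]
  rw [inv_smul_eq_iff₀ hpos.ne', smul_dehom hpos.ne']

/-- The cone over a flat is a simplicial section of the cone over the domain. -/
theorem IsFlatWith.isFlatTuple (hC : IsProperCone (coneOver Ω)) (hd : 0 < d)
    {v : Fin d → Euc d} (hv : IsFlatWith Ω v) :
    IsFlatTuple (coneOver Ω) fun i => (v i, (1 : ℝ)) := by
  obtain ⟨hind, hmem, h_sub, hbdry⟩ := hv
  have hne : Nonempty (Fin d) := ⟨⟨0, hd⟩⟩
  have hcl : ∀ i, (v i, (1 : ℝ)) ∈ closure (coneOver Ω) := fun i =>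
    mk_one_mem_closure_coneOver (hmem i).1
  have hpos : ∀ c : Fin d → ℝ, (∀ i, 0 < c i) → ∑ i, c i • (v i, (1 : ℝ)) ∈ coneOver Ω := by
    intro c hc
    have h1 : 0 < (∑ i, c i • (v i, (1 : ℝ))).2 := by
      rw [sum_smul_mk_one]
      exact Finset.sum_pos (fun i _ => hc i) Finset.univ_nonempty
    refine mem_coneOver_iff.2 ⟨h1, h_sub ?_⟩
    rw [intrinsicInterior_eq_openSimplex hind]
    exact dehom_sum_mem_openSimplex hc h1
  refine fun c => ⟨fun h => ?_, hpos c⟩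
  obtain ⟨i, hi⟩ := Finite.exists_min c
  by_contra! hneg
  obtain ⟨j, hj⟩ := hneg
  have hci : c i ≤ 0 := (hi j).trans hj
  have h1 : ∑ k, (c k - c i) • (v k, (1 : ℝ)) ∈ coneOver Ω := by
    have h2 := hC.add_sum_mem h hcl fun _ => neg_nonneg.2 hci
    rwa [← Finset.sum_add_distrib, Finset.sum_congr rfl fun k _ => ?_] at h2
    rw [← add_smul, ← sub_eq_add_neg]
  obtain ⟨hs, hx⟩ := mem_coneOver_iff.1 h1
  have h3 : dehom (∑ k, (c k - c i) • (v k, (1 : ℝ))) ∈ convexHull ℝ (range v) := by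
    rw [sum_smul_mk_one] at hs ⊢
    rw [dehom, Finset.smul_sum]
    simp only [smul_smul]
    refine (convex_convexHull ℝ _).sum_mem (fun k _ => ?_) ?_
      fun k _ => subset_convexHull ℝ _ ⟨k, rfl⟩
    · exact mul_nonneg (inv_pos.2 hs).le (sub_nonneg.2 (hi k))
    · rw [← Finset.mul_sum, inv_mul_cancel₀ hs.ne']
  have h4 : dehom (∑ k, (c k - c i) • (v k, (1 : ℝ))) ∈ openSimplex fun i => (v i, (1 : ℝ)) := by
    rw [← intrinsicInterior_eq_openSimplex hind]
    by_contra h5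
    exact (hbdry ⟨h3, h5⟩).2 hx
  obtain ⟨b, hb, hbx⟩ := h4
  have h5 := congrArg ((∑ k, (c k - c i) • (v k, (1 : ℝ))).2 • ·) hbx
  simp only [Finset.smul_sum, smul_smul] at h5
  rw [smul_dehom hs.ne', ← sub_eq_zero, ← Finset.sum_sub_distrib] at h5
  simp only [← sub_smul] at h5
  have h6 := Fintype.linearIndependent_iff.1 hind.linearIndependent_prodMk_one _ h5 i
  rw [sub_self, sub_zero] at h6
  exact (mul_pos hs (hb i)).ne' h6

/-- Simplicial sections of the cone over the domain come from flats. -/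
theorem IsFlatTuple.isFlat (hbd : Bornology.IsBounded Ω) (hC : IsProperCone (coneOver Ω))
    (hconv : Convex ℝ Ω) (hd : 2 ≤ d) {w : Fin d → Euc d × ℝ}
    (hw : IsFlatTuple (coneOver Ω) w) : IsFlat Ω (openSimplex w) := by
  classical
  have hcard : Fintype.card (Fin d) + 1 = Module.finrank ℝ (Euc d × ℝ) := by simp
  have hne : ∀ i, w i ≠ 0 := by
    obtain ⟨Fr, rfl⟩ := hw.exists_frame hC hcard
    intro i h0
    simpa [h0] using Fr.ξ_self i
  have hsnd : ∀ i, 0 < (w i).2 := fun i => snd_pos_of_mem_closure hbd (hw.mem_closure i) (hne i)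
  let v : Fin d → Euc d := fun i => dehom (w i)
  have hvw : ∀ i, (v i, (1 : ℝ)) = (w i).2⁻¹ • w i := fun i => by
    rw [eq_inv_smul_iff₀ (hsnd i).ne', smul_dehom (hsnd i).ne']
  have hu : IsFlatTuple (coneOver Ω) fun i => (v i, (1 : ℝ)) := by
    simp only [hvw]
    exact hw.smul fun i => inv_pos.2 (hsnd i)
  have hopen : openSimplex w = openSimplex fun i => (v i, (1 : ℝ)) := by
    simp only [hvw]
    exact (openSimplex_smul fun i => inv_pos.2 (hsnd i)).symm
  have hind : AffineIndependent ℝ v := by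
    obtain ⟨Fr, hFr⟩ := hu.exists_frame hC hcard
    rw [affineIndependent_iff_eq_of_fintype_affineCombination_eq]
    intro a b ha hb hab
    rw [Finset.affineCombination_eq_linear_combination _ _ _ ha,
      Finset.affineCombination_eq_linear_combination _ _ _ hb] at hab
    have h1 : ∑ i, a i • Fr.w i = ∑ i, b i • Fr.w i := by
      rw [hFr, sum_smul_mk_one, sum_smul_mk_one, hab, ha, hb]
    ext i
    rw [← Fr.ξ_sum a i, h1, Fr.ξ_sum]
  have hvcl : ∀ i, v i ∈ closure Ω := fun i =>
    dehom_mem_closure (hw.mem_closure i) (hsnd i).ne'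
  have h_sub := intrinsicInterior_eq_openSimplex hind
  have hmem : ∀ c : Fin d → ℝ, ∑ i, c i = 1 → ∑ i, c i • v i ∈ Ω → ∀ i, 0 < c i := by
    intro c hc hx
    rw [← hu, sum_smul_mk_one, hc]
    exact mk_one_mem_coneOver.2 hx
  refine ⟨v, ⟨hind, fun j => ⟨hvcl j, fun hj => ?_⟩, ?_, ?_⟩, hopen.trans h_sub.symm⟩
  · have hnt : Nontrivial (Fin d) := Fin.nontrivial_iff_two_le.2 hd
    obtain ⟨i, hi⟩ := exists_ne j
    have := hmem (fun k => if k = j then 1 else 0) (by simp) (by simpa [ite_smul] using hj) i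
    simp [hi] at this
  · rw [h_sub]
    rintro x ⟨c, hc, hx⟩
    exact mk_one_mem_coneOver.1 (hx ▸ (hu c).2 hc)
  · rintro x ⟨hx, hxn⟩
    refine ⟨convexHull_min (range_subset_iff.2 hvcl) hconv.closure hx, fun hxΩ => hxn ?_⟩
    have h1 := convexHull_subset_affineSpan (𝕜 := ℝ) (range v) hx
    obtain ⟨c, hc, rfl⟩ := eq_affineCombination_of_mem_affineSpan_of_fintype h1
    rw [Finset.affineCombination_eq_linear_combination _ _ _ hc] at hxΩ ⊢
    rw [h_sub]
    exact ⟨c, hmem c hc hxΩ, by rw [sum_smul_mk_one, hc]⟩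

/-- A functional that is nonnegative on an open simplicial cone and vanishes somewhere on it
vanishes on its rays. -/
theorem eq_zero_of_sum_nonneg {ι : Type*} [Fintype ι] {x c : ι → ℝ} (hc : ∀ i, 0 < c i)
    (h0 : ∑ i, c i * x i = 0) (h : ∀ a : ι → ℝ, (∀ i, 0 < a i) → 0 ≤ ∑ i, a i * x i) (i : ι) :
    x i = 0 := by
  classical
  have hx : ∀ j, 0 ≤ x j := by
    intro j
    have h1 := h (fun k => c k + if k = j then 1 else 0) fun k => by
      have := hc k
      split_ifs <;> linarith
    simpa [add_mul, Finset.sum_add_distrib, h0] using h1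
  have h2 := (Finset.sum_eq_zero_iff_of_nonneg fun j _ => mul_nonneg (hc j).le (hx j)).1 h0 i
    (Finset.mem_univ i)
  exact (mul_eq_zero.1 h2).resolve_left (hc i).ne'

/-- A boundary flat is not crossed by other flats. -/
theorem IsBoundaryFlat.isUncrossed (hbd : Bornology.IsBounded Ω)
    (hC : IsProperCone (coneOver Ω)) (hconv : Convex ℝ Ω) (hd : 2 ≤ d) {v : Fin d → Euc d}
    (hv : IsFlatWith Ω v)
    (hF : IsBoundaryFlat Ω (intrinsicInterior ℝ (convexHull ℝ (range v)))) :
    IsUncrossed (coneOver Ω) fun i => (v i, (1 : ℝ)) := by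
  have hcard : Fintype.card (Fin d) + 1 = Module.finrank ℝ (Euc d × ℝ) := by simp
  intro w' hw' ⟨c, b, hc, hb, hcb⟩ k
  obtain ⟨Fr, hFr⟩ := (hv.isFlatTuple hC (by omega)).exists_frame hC hcard
  obtain ⟨Fr', rfl⟩ := hw'.exists_frame hC hcard
  obtain ⟨-, x, -, hW⟩ := hF
  rw [intrinsicInterior_eq_openSimplex hv.1] at hW
  set W := connectedComponentIn (Ω \ flatsUnion Ω) x
  have hcont : Continuous fun y : Euc d => Fr'.η (y, (1 : ℝ)) := by fun_prop
  have hWne : ∀ y ∈ W, Fr'.η (y, (1 : ℝ)) ≠ 0 := by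
    intro y hy h0
    obtain ⟨hyΩ, hyn⟩ := connectedComponentIn_subset _ _ hy
    refine hyn ⟨_, hw'.isFlat hbd hC hconv hd, fun i => Fr'.ξ i (y, 1), fun i => ?_,
      Fr'.eq_sum_of_η_eq_zero h0⟩
    exact Fr'.pos i _ (mk_one_mem_coneOver.2 hyΩ)
  have hsign : (∀ y ∈ W, 0 ≤ Fr'.η (y, (1 : ℝ))) ∨ ∀ y ∈ W, Fr'.η (y, (1 : ℝ)) ≤ 0 := by
    by_contra! hcon
    obtain ⟨⟨y, hy, hy0⟩, z, hz, hz0⟩ := hcon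
    obtain ⟨p, hp, hp0⟩ := isPreconnected_connectedComponentIn.intermediate_value hy hz
      hcont.continuousOn ⟨hy0.le, hz0.le⟩
    exact hWne p hp hp0
  have hpt : ∀ a : Fin d → ℝ, (∀ i, 0 < a i) →
      ∃ s : ℝ, 0 < s ∧ ∃ y ∈ closure W, ∑ i, a i * Fr'.η (Fr.w i) = s * Fr'.η (y, (1 : ℝ)) := by
    intro a ha
    have h1 : 0 < (∑ i, a i • Fr.w i).2 :=
      (mem_coneOver_iff.1 ((Fr.isFlatTuple hC a).2 ha)).1
    refine ⟨_, h1, dehom (∑ i, a i • Fr.w i), hW ?_, ?_⟩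
    · rw [← hFr]
      exact dehom_sum_mem_openSimplex ha h1
    · rw [← smul_eq_mul (∑ i, a i • Fr.w i).2, ← map_smul, smul_dehom h1.ne']
      simp
  have h0 : ∑ i, c i * Fr'.η (Fr.w i) = 0 := by
    have h1 := congrArg Fr'.η hcb
    rw [Fr'.η_sum, map_sum] at h1
    rw [hFr]
    simpa only [map_smul, smul_eq_mul] using h1
  have hvan : ∀ i, Fr'.η (Fr.w i) = 0 := by
    rcases hsign with h | h
    · refine eq_zero_of_sum_nonneg hc h0 fun a ha => ?_
      obtain ⟨s, hs, y, hy, heq⟩ := hpt a ha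
      rw [heq]
      exact mul_nonneg hs.le
        (closure_minimal h (isClosed_le continuous_const hcont) hy)
    · intro i
      rw [← neg_eq_zero]
      refine eq_zero_of_sum_nonneg (x := fun i => -Fr'.η (Fr.w i)) hc (by simpa using h0)
        (fun a ha => ?_) i
      obtain ⟨s, hs, y, hy, heq⟩ := hpt a ha
      simp only [mul_neg, Finset.sum_neg_distrib, heq, Left.nonneg_neg_iff]
      exact mul_nonpos_of_nonneg_of_nonpos hs.le
        (closure_minimal h (isClosed_le hcont continuous_const) hy)
  have hη : Fr.η (Fr'.w k) = 0 :=
    Fr.η_eq_zero_of_vanish hvan (u := Fr'.e) (by simp [Fr'.η_e]) (Fr'.η_w k)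
  exact ⟨_, by rw [← Fr.eq_sum_of_η_eq_zero hη, hFr]⟩

end FlatsOfDomain

section Action

variable {d : ℕ} {Ω : Set (Euc d)}

theorem projAct_dehom {g : (Euc d × ℝ) ≃ₗ[ℝ] (Euc d × ℝ)} {p : Euc d × ℝ} (hp : p.2 ≠ 0) :
    projAct g (dehom p) = dehom (g p) := by
  conv_rhs => rw [← smul_dehom hp, map_smul, dehom_smul hp]
  rfl

theorem mem_coneOver_iff_of_image_eq {γ : (Euc d × ℝ) ≃ₗ[ℝ] (Euc d × ℝ)}
    (h : γ '' coneOver Ω = coneOver Ω) (p : Euc d × ℝ) : γ p ∈ coneOver Ω ↔ p ∈ coneOver Ω := by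
  conv_lhs => rw [← h]
  exact γ.injective.mem_set_image

/-- A group dividing `Ω` moves the cone over `Ω`, up to scale, into a compact set. -/
theorem Divides.exists_compact {Γ : Subgroup ((Euc d × ℝ) ≃ₗ[ℝ] (Euc d × ℝ))}
    (hdiv : Divides Ω Γ) : ∃ K ⊆ coneOver Ω, IsCompact K ∧
      ∀ p ∈ coneOver Ω, ∃ γ ∈ Γ, ∃ s : ℝ, 0 < s ∧ s • γ p ∈ K := by
  obtain ⟨hcone, -, -, K, hKΩ, hK, hcov⟩ := hdiv
  refine ⟨(fun x => (x, (1 : ℝ))) '' K, ?_, hK.image (by fun_prop), fun p hp => ?_⟩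
  · rintro _ ⟨x, hx, rfl⟩
    exact mk_one_mem_coneOver.2 (hKΩ hx)
  obtain ⟨hp2, hpΩ⟩ := mem_coneOver_iff.1 hp
  rw [← hcov] at hpΩ
  simp only [mem_iUnion] at hpΩ
  obtain ⟨γ, hγ, y, hy, hyp⟩ := hpΩ
  have h1 : 0 < (γ (y, 1)).2 := (mem_coneOver_iff.1
    ((mem_coneOver_iff_of_image_eq (hcone γ hγ) _).2 (mk_one_mem_coneOver.2 (hKΩ hy)))).1
  refine ⟨γ⁻¹, inv_mem hγ, (γ (y, 1)).2 / p.2, div_pos h1 hp2, y, hy, ?_⟩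
  change _ = _ • γ.symm p
  rw [← map_smul, eq_comm, LinearEquiv.symm_apply_eq, div_eq_mul_inv, mul_smul,
    ← smul_dehom h1.ne', inv_smul_eq_iff₀ hp2.ne' |>.2 (smul_dehom hp2.ne').symm, ← hyp]
  simp [dehom, projAct]

theorem Divides.eq_one_of_apply_eq_smul {Γ : Subgroup ((Euc d × ℝ) ≃ₗ[ℝ] (Euc d × ℝ))}
    (hdiv : Divides Ω Γ) {γ : (Euc d × ℝ) ≃ₗ[ℝ] (Euc d × ℝ)} (hγ : γ ∈ Γ) {p : Euc d × ℝ}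
    (hp : p ∈ coneOver Ω) {s : ℝ} (h : γ p = s • p) : γ = 1 := by
  by_contra hne
  obtain ⟨hp2, hpΩ⟩ := mem_coneOver_iff.1 hp
  refine hdiv.2.1 γ hγ hne _ hpΩ ?_
  have h1 := (mem_coneOver_iff.1 ((mem_coneOver_iff_of_image_eq (hdiv.1 γ hγ) p).2 hp)).1
  have hs : s ≠ 0 := by
    rintro rfl
    simp [h] at h1
  rw [projAct_dehom hp2.ne', h, dehom_smul hs]

theorem Divides.finite_compact {Γ : Subgroup ((Euc d × ℝ) ≃ₗ[ℝ] (Euc d × ℝ))}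
    (hdiv : Divides Ω Γ) {K : Set (Euc d × ℝ)} (hKC : K ⊆ coneOver Ω) (hK : IsCompact K) :
    {γ | γ ∈ Γ ∧ ∃ p ∈ K, ∃ s : ℝ, s • γ p ∈ K}.Finite := by
  have hsnd : ∀ p ∈ K, p.2 ≠ 0 := fun p hp => (mem_coneOver_iff.1 (hKC hp)).1.ne'
  refine (hdiv.2.2.1 (dehom '' K) ?_ (hK.image_of_continuousOn fun p hp =>
    (continuousAt_dehom (hsnd p hp)).continuousWithinAt)).subset ?_
  · rintro _ ⟨p, hp, rfl⟩
    exact (mem_coneOver_iff.1 (hKC hp)).2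
  · rintro γ ⟨hγ, p, hp, s, hs⟩
    refine ⟨hγ, _, ⟨_, ⟨p, hp, rfl⟩, rfl⟩, _, hs, ?_⟩
    have hs0 : s ≠ 0 := by
      rintro rfl
      have := hsnd _ hs
      simp at this
    rw [projAct_dehom (hsnd p hp), dehom_smul hs0]

/-- Positive scalar multiples of linear automorphisms of a cone are automorphisms of it. -/
theorem exists_isConeAut_smul {V : Type*} [NormedAddCommGroup V] [NormedSpace ℝ V]
    [FiniteDimensional ℝ V] {C : Set V} (hC : IsProperCone C) {γ : V ≃ₗ[ℝ] V}
    (hγ : ∀ v, γ v ∈ C ↔ v ∈ C) {s : ℝ} (hs : 0 < s) :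
    ∃ g : V ≃L[ℝ] V, IsConeAut C g ∧ ∀ v, g v = s • γ v := by
  refine ⟨(γ.trans (LinearEquiv.smulOfNeZero ℝ V s hs.ne')).toContinuousLinearEquiv,
    fun v => ?_, fun v => rfl⟩
  change s • γ v ∈ C ↔ v ∈ C
  rw [← hγ v]
  refine ⟨fun h => ?_, hC.smul_mem s hs _⟩
  have := hC.smul_mem s⁻¹ (inv_pos.2 hs) _ h
  rwa [smul_smul, inv_mul_cancel₀ hs.ne', one_smul] at this

theorem image_openSimplex_subset {Γ : Subgroup ((Euc d × ℝ) ≃ₗ[ℝ] (Euc d × ℝ))}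
    (hdiv : Divides Ω Γ) {w : Fin d → Euc d × ℝ} (hw : IsFlatTuple (coneOver Ω) w)
    {γ : (Euc d × ℝ) ≃ₗ[ℝ] (Euc d × ℝ)} (hγ : γ ∈ rayStabilizer Γ w) :
    projAct γ '' openSimplex w ⊆ openSimplex w := by
  rintro _ ⟨x, ⟨c, hc, hx⟩, rfl⟩
  choose l hl using hγ.2
  have h1 : γ (x, 1) = ∑ i, (c i * Real.exp (l i)) • w i := by
    simp only [← hx, map_sum, map_smul, hl, smul_smul]
  have h2 := (mem_coneOver_iff.1 ((mem_coneOver_iff_of_image_eq (hdiv.1 γ hγ.1) _).2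
    ((hw c).2 hc))).1
  rw [hx, h1] at h2
  have h3 := dehom_sum_mem_openSimplex (fun i => mul_pos (hc i) (Real.exp_pos (l i))) h2
  rwa [← h1] at h3

end Action

theorem boundary_flat_stabilizer_full_rank {d : ℕ} (Ω : Set (Euc d)) (hne : Ω.Nonempty)
    (hbd : Bornology.IsBounded Ω) (hop : IsOpen Ω) (hconv : Convex ℝ Ω)
    (hd : 3 ≤ d) (hirr : IsIrreducibleDomain Ω)
    (Γ : Subgroup ((Euc d × ℝ) ≃ₗ[ℝ] (Euc d × ℝ)))
    (htf : TorsionFreeSub Γ) (hdiv : Divides Ω Γ)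
    (F : Set (Euc d)) (hF : IsBoundaryFlat Ω F) :
    ∃ H : Subgroup ((Euc d × ℝ) ≃ₗ[ℝ] (Euc d × ℝ)),
      (↑H : Set ((Euc d × ℝ) ≃ₗ[ℝ] (Euc d × ℝ))) ⊆
        {γ | γ ∈ Γ ∧ projAct γ '' F = F} ∧
      Nonempty (H ≃* Multiplicative (Fin (d - 1) → ℤ)) ∧
      ∃ T : Finset ((Euc d × ℝ) ≃ₗ[ℝ] (Euc d × ℝ)),
        ∀ γ ∈ Γ, projAct γ '' F = F → ∃ t ∈ T, ∃ h ∈ H, γ = t * h := by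
  have hC := isProperCone_coneOver hbd hop hconv
  have hray := hirr.isRayIrreducible hC (by omega)
  have hcard : Fintype.card (Fin d) + 1 = Module.finrank ℝ (Euc d × ℝ) := by simp
  have hΓ : ∀ γ ∈ Γ, ∀ p, γ p ∈ coneOver Ω ↔ p ∈ coneOver Ω := fun γ hγ =>
    mem_coneOver_iff_of_image_eq (hdiv.1 γ hγ)
  obtain ⟨K, hKC, hK, hcov⟩ := hdiv.exists_compact
  have hQ : IsQuasiHomogeneous (coneOver Ω) K :=
    { hC with
      subset := hKC
      isCompact := hK
      exists_aut := fun p hp => by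
        obtain ⟨γ, hγ, s, hs, hm⟩ := hcov p hp
        obtain ⟨g, hg, hgp⟩ := exists_isConeAut_smul hC (hΓ γ hγ) hs
        exact ⟨g, hg, by rwa [hgp]⟩ }
  obtain ⟨v, hv, rfl⟩ := hF.1
  have hun := hF.isUncrossed hbd hC hconv (by omega) hv
  have hw := hv.isFlatTuple hC (by omega)
  rw [intrinsicInterior_eq_openSimplex hv.1]
  set w : Fin d → Euc d × ℝ := fun i => (v i, 1)
  obtain ⟨R, hR⟩ := hQ.exists_relatively_dense hray hcard (by simpa using hd) hΓ hcov hw hun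
  obtain ⟨Fr, hFr⟩ := hw.exists_frame hC hcard
  have : Nonempty (Fin d) := ⟨⟨0, by omega⟩⟩
  obtain ⟨T, hT⟩ := exists_finset_rayStabilizer Γ w
  refine ⟨rayStabilizer Γ w, fun γ hγ => ⟨hγ.1, ?_⟩, ?_, T, fun γ hγ himg => hT γ hγ ?_⟩
  · refine (image_openSimplex_subset hdiv hw hγ).antisymm fun x hx => ?_
    refine ⟨_, image_openSimplex_subset hdiv hw (inv_mem hγ) ⟨x, hx, rfl⟩, ?_⟩
    obtain ⟨c, hc, hcx⟩ := hx
    have h1 := (mem_coneOver_iff.1 ((hΓ _ (inv_mem hγ.1) _).2 ((hw c).2 hc))).1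
    rw [hcx] at h1
    change projAct γ (dehom _) = x
    rw [projAct_dehom h1.ne', ← LinearEquiv.mul_apply, mul_inv_cancel]
    simp [dehom]
  · have h1 := Fr.nonempty_rayStabilizer_mulEquiv (R := R) hC
      (fun γ hγ p hp s h => hdiv.eq_one_of_apply_eq_smul hγ hp h)
      (fun K' hK' hc => hdiv.finite_compact hK' hc) (by rwa [hFr])
    rwa [hFr, Fintype.card_fin] at h1
  · have hγw : IsFlatTuple (coneOver Ω) fun i => γ (w i) :=
      hw.map (g := γ.toContinuousLinearEquiv) (hΓ γ hγ)
    have hx : dehom (∑ i, w i) ∈ openSimplex w := by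
      have := dehom_sum_mem_openSimplex (w := w) (c := fun _ => 1) (fun _ => one_pos)
        (by simpa using (mem_coneOver_iff.1 hw.sum_mem).1)
      simpa using this
    have hmeet : Meets w fun i => γ (w i) := by
      obtain ⟨c, hc, hcx⟩ := hx
      have hx' : projAct γ (dehom (∑ i, w i)) ∈ openSimplex w := by
        rw [← himg]
        exact ⟨_, ⟨c, hc, hcx⟩, rfl⟩
      obtain ⟨b, hb, hbx⟩ := hx'
      have h1 := (mem_coneOver_iff.1 ((hΓ γ hγ _).2 ((hw c).2 hc))).1
      rw [hcx] at h1
      refine ⟨fun i => (γ (dehom (∑ i, w i), 1)).2 * b i, c, fun i => mul_pos h1 (hb i), hc, ?_⟩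
      simp only [mul_smul, ← Finset.smul_sum, hbx, ← map_smul, ← map_sum, hcx]
      exact smul_dehom h1.ne'
    obtain ⟨Fr', hFr'⟩ := hγw.exists_frame hC hcard
    have hη : ∀ k, Fr.η (Fr'.w k) = 0 := by
      intro k
      obtain ⟨c, hck⟩ := hun _ hγw hmeet k
      have h1 := Fr.η_sum c
      rwa [hFr, hck, ← congrFun hFr' k] at h1
    have hη' : ∀ k, Fr'.η (Fr.w k) = 0 := fun k =>
      Fr'.η_eq_zero_of_vanish hη (u := Fr.e) (by simp [Fr.η_e]) (Fr.η_w k)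
    intro j
    obtain ⟨k, hk⟩ : ∃ k, 0 < Fr.ξ k (Fr'.w j) := by
      by_contra! hall
      have h0 : Fr'.w j = 0 := by
        rw [← Fr.eq_sum_of_η_eq_zero (hη j)]
        refine Finset.sum_eq_zero fun k _ => ?_
        rw [le_antisymm (hall k) (Fr.ξ_nonneg k (Fr'.w_mem j)), zero_smul]
      simpa [h0] using Fr'.ξ_self j
    have := Fr.eq_smul_of_pos Fr' hη' hk
    rw [hFr', hFr] at this
    rw [hFr'] at hk
    exact ⟨k, _, hk, this⟩
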